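/- arXiv:2106.15337 — 3 statements merged into one kernel-verified Lean document; each statement's English description precedes it below -/
import Mathlib

section
/- Every finite poset of width d (maximum antichain size d) has natural twin-width at most 9d − 6. -/
/-- All elements of block `B` lie below all elements of block `C`. -/
def blockLE {X : Type*} (le : X → X → Prop) (B C : Finset X) : Prop :=
  ∀ x ∈ B, ∀ y ∈ C, le x y

/-- Two blocks form a red pair (non-homogeneous zone between incomparable blocks):
neither block lies entirely below the other, yet some pair of elements is comparable. -/
def RedPair {X : Type*} (le : X → X → Prop) (B C : Finset X) : Prop :=
  ¬ blockLE le B C ∧ ¬ blockLE le C B ∧ ∃ x ∈ B, ∃ y ∈ C, le x y ∨ le y x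

open Classical in
/-- Red degree of the part `B` in the partition `P`. -/
noncomputable def redDeg {X : Type*} (le : X → X → Prop)
    (P : Finset (Finset X)) (B : Finset X) : ℕ :=
  (P.filter fun C => C ≠ B ∧ RedPair le B C).card

/-- `P` is a partition of the (finite) type `X` into nonempty parts. -/
def IsPartitionOf {X : Type*} (P : Finset (Finset X)) : Prop :=
  (∀ B ∈ P, B.Nonempty) ∧ ∀ x : X, ∃! B, B ∈ P ∧ x ∈ B

/-- `Q` is obtained from `P` by merging (contracting) two of its parts. -/
def MergeStep {X : Type*} [DecidableEq X] (P Q : Finset (Finset X)) : Prop :=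
  ∃ B ∈ P, ∃ C ∈ P, B ≠ C ∧ Q = insert (B ∪ C) ((P.erase B).erase C)

/-- The natural twin-width of the poset `(X, le)` is at most `d`: there is a
contraction sequence from the partition into singletons down to the one-part
partition, merging two parts at each step, whose red degree never exceeds `d`. -/
def NatTwinWidthLE {X : Type*} [Fintype X] [DecidableEq X]
    (le : X → X → Prop) (d : ℕ) : Prop :=
  ∃ (n : ℕ) (seq : Fin (n + 1) → Finset (Finset X)),
    (∀ i, IsPartitionOf (seq i)) ∧
    seq 0 = Finset.univ.image (fun x => ({x} : Finset X)) ∧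
    seq (Fin.last n) = {Finset.univ} ∧
    (∀ i : Fin n, MergeStep (seq i.castSucc) (seq i.succ)) ∧
    ∀ i, ∀ B ∈ seq i, redDeg le (seq i) B ≤ d

theorem dilworth_aux {X : Type*} [PartialOrder X] [DecidableEq X] (S : Finset X) :
    ∃ (c : X → ℕ) (A : Finset X), A ⊆ S ∧ IsAntichain (· ≤ ·) (A : Set X) ∧
      (∀ x ∈ S, c x < A.card) ∧ ∀ x ∈ S, ∀ y ∈ S, c x = c y → x ≤ y ∨ y ≤ x := by
  classical
  induction S using Finset.strongInduction with
  | H S ih =>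
    rcases S.eq_empty_or_nonempty with rfl | hS
    · exact ⟨fun _ => 0, ∅, by simp⟩
    obtain ⟨a, ha⟩ := S.exists_maximal hS
    have haS : a ∈ S := ha.1
    have hmax : ∀ x ∈ S, a ≤ x → x = a := fun x hx h => le_antisymm (ha.2 hx h) h
    obtain ⟨c, A, hAS, hA, hc, hch⟩ := ih (S.erase a) (Finset.erase_ssubset haS)
    set k := A.card with hk
    -- every k-antichain hits every colour
    have hit : ∀ B : Finset X, B ⊆ S.erase a → IsAntichain (· ≤ ·) (B : Set X) → B.card = k →
        ∀ i < k, ∃ x ∈ B, c x = i := by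
      intro B hB hBa hBk i hi
      have hinj : Set.InjOn c (B : Set X) := by
        intro x hx y hy hxy
        by_contra hne
        rcases hch x (hB hx) y (hB hy) hxy with h | h
        · exact hBa hx hy hne h
        · exact hBa hy hx (Ne.symm hne) h
      have : B.image c = Finset.range k := by
        apply Finset.eq_of_subset_of_card_le
        · intro j hj
          obtain ⟨x, hx, rfl⟩ := Finset.mem_image.1 hj
          exact Finset.mem_range.2 (hc x (hB hx))
        · rw [Finset.card_image_of_injOn hinj, hBk, Finset.card_range]
      have hmem : i ∈ B.image c := by rw [this]; exact Finset.mem_range.2 hi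
      simpa using hmem
    -- top elements
    have top : ∀ i : ℕ, ∃ x : X, i < k → (x ∈ S.erase a ∧ c x = i ∧
        (∃ B : Finset X, B ⊆ S.erase a ∧ IsAntichain (· ≤ ·) (B : Set X) ∧ B.card = k ∧ x ∈ B) ∧
        ∀ B : Finset X, B ⊆ S.erase a → IsAntichain (· ≤ ·) (B : Set X) → B.card = k →
          ∀ y ∈ B, c y = i → y ≤ x) := by
      intro i
      by_cases hi : i < k
      swap
      · exact ⟨a, fun h => absurd h hi⟩
      let W := (S.erase a).filter fun x => c x = i ∧
        ∃ B : Finset X, B ⊆ S.erase a ∧ IsAntichain (· ≤ ·) (B : Set X) ∧ B.card = k ∧ x ∈ B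
      have hW : W.Nonempty := by
        obtain ⟨x, hx, hxi⟩ := hit A hAS hA rfl i hi
        exact ⟨x, Finset.mem_filter.2 ⟨hAS hx, hxi, A, hAS, hA, rfl, hx⟩⟩
      obtain ⟨x, hx⟩ := W.exists_maximal hW
      obtain ⟨hx1, hx2, hx3⟩ := Finset.mem_filter.1 hx.1
      refine ⟨x, fun _ => ⟨hx1, hx2, hx3, ?_⟩⟩
      intro B hB hBa hBk y hy hyi
      rcases hch y (hB hy) x hx1 (hyi.trans hx2.symm) with h | h
      · exact h
      · exact hx.2 (Finset.mem_filter.2 ⟨hB hy, hyi, B, hB, hBa, hBk, hy⟩) h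
    choose t ht using top
    let D := (Finset.range k).image t
    have hDsub : D ⊆ S.erase a := by
      intro x hx
      obtain ⟨i, hi, rfl⟩ := Finset.mem_image.1 hx
      exact (ht i (Finset.mem_range.1 hi)).1
    have hDcard : D.card = k := by
      rw [Finset.card_image_of_injOn, Finset.card_range]
      intro i hi j hj hij
      have h1 := (ht i (Finset.mem_range.1 hi)).2.1
      have h2 := (ht j (Finset.mem_range.1 hj)).2.1
      rw [← h1, ← h2]; exact congrArg c hij
    have hDanti : IsAntichain (· ≤ ·) (D : Set X) := by
      intro x hx y hy hne hle
      obtain ⟨i, hi, rfl⟩ := Finset.mem_image.1 (Finset.mem_coe.1 hx)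
      obtain ⟨j, hj, rfl⟩ := Finset.mem_image.1 (Finset.mem_coe.1 hy)
      have h1 := ht i (Finset.mem_range.1 hi)
      have h2 := ht j (Finset.mem_range.1 hj)
      obtain ⟨B, hB, hBa, hBk, hyB⟩ := h2.2.2.1
      obtain ⟨z, hz, hzi⟩ := hit B hB hBa hBk i (Finset.mem_range.1 hi)
      have hzx := h1.2.2.2 B hB hBa hBk z hz hzi
      refine hBa hz hyB ?_ (hzx.trans hle)
      rintro rfl
      apply hne
      rw [← hzi, h2.2.1]
    have hDS : D ⊆ S := hDsub.trans (Finset.erase_subset _ _)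
    by_cases hinc : ∃ i < k, t i ≤ a
    · obtain ⟨i, hi, hia⟩ := hinc
      let S' := (S.erase a).filter fun z => ¬ (c z = i ∧ z ≤ t i)
      have hS' : S' ⊂ S :=
        lt_of_le_of_lt (Finset.filter_subset _ _) (Finset.erase_ssubset haS)
      obtain ⟨c', A', hA'S, hA', hc', hch'⟩ := ih S' hS'
      have hA'e : A' ⊆ S.erase a := hA'S.trans (Finset.filter_subset _ _)
      have hlt : A'.card < k := by
        by_contra hge
        push Not at hge
        obtain ⟨B, hBA, hBk⟩ := Finset.exists_subset_card_eq hge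
        have hBa : IsAntichain (· ≤ ·) (B : Set X) := hA'.subset (by exact_mod_cast hBA)
        obtain ⟨z, hz, hzi⟩ := hit B (hBA.trans hA'e) hBa hBk i hi
        have := (ht i hi).2.2.2 B (hBA.trans hA'e) hBa hBk z hz hzi
        exact (Finset.mem_filter.1 (hA'S (hBA hz))).2 ⟨hzi, this⟩
      refine ⟨fun x => if x ∈ S' then c' x else A'.card, D, hDS, hDanti, ?_, ?_⟩
      · intro x hx
        rw [hDcard]
        dsimp only
        split_ifs with h
        · exact (hc' x h).trans hlt
        · exact hlt
      · have key : ∀ x ∈ S, x ∉ S' → x = a ∨ (x ∈ S.erase a ∧ c x = i ∧ x ≤ t i) := by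
          intro x hx hx'
          by_cases hxa : x = a
          · exact Or.inl hxa
          · right
            have hxe : x ∈ S.erase a := Finset.mem_erase.2 ⟨hxa, hx⟩
            by_contra hcon
            exact hx' (Finset.mem_filter.2 ⟨hxe, fun h => hcon ⟨hxe, h⟩⟩)
        intro x hx y hy hxy
        dsimp only at hxy
        split_ifs at hxy with h1 h2 h2
        · exact hch' x h1 y h2 hxy
        · exact absurd hxy (hc' x h1).ne
        · exact absurd hxy.symm (hc' y h2).ne
        · rcases key x hx h1 with rfl | ⟨e1, e2, e3⟩ <;> rcases key y hy h2 with rfl | ⟨f1, f2, f3⟩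
          · exact Or.inl le_rfl
          · exact Or.inr (f3.trans hia)
          · exact Or.inl (e3.trans hia)
          · exact hch x e1 y f1 (e2.trans f2.symm)
    · push Not at hinc
      have haD : a ∉ D := fun h => by simpa using hDsub h
      refine ⟨fun x => if x = a then k else c x, insert a D, ?_, ?_, ?_, ?_⟩
      · exact Finset.insert_subset haS hDS
      · rw [Finset.coe_insert]
        refine hDanti.insert ?_ ?_
        · intro b hb hne hle
          obtain ⟨i, hi, rfl⟩ := Finset.mem_image.1 (Finset.mem_coe.1 hb)
          exact hinc i (Finset.mem_range.1 hi) hle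
        · intro b hb hne hle
          exact hne (hmax b (hDS hb) hle).symm
      · intro x hx
        rw [Finset.card_insert_of_notMem haD, hDcard]
        dsimp only
        split_ifs with h
        · omega
        · exact (hc x (Finset.mem_erase.2 ⟨h, hx⟩)).trans (Nat.lt_succ_self _)
      · intro x hx y hy hxy
        dsimp only at hxy
        split_ifs at hxy with h1 h2 h2
        · rw [h1, h2]; exact Or.inl le_rfl
        · exact absurd hxy.symm (hc y (Finset.mem_erase.2 ⟨h2, hy⟩)).ne
        · exact absurd hxy (hc x (Finset.mem_erase.2 ⟨h1, hx⟩)).ne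
        · exact hch x (Finset.mem_erase.2 ⟨h1, hx⟩) y (Finset.mem_erase.2 ⟨h2, hy⟩) hxy

/-! ### Building contraction sequences -/

/-- There is a good contraction sequence starting at `P`. -/
def GoodFrom {X : Type*} [Fintype X] [DecidableEq X] (le : X → X → Prop) (d : ℕ)
    (P : Finset (Finset X)) : Prop :=
  ∃ (n : ℕ) (seq : Fin (n + 1) → Finset (Finset X)),
    (∀ i, IsPartitionOf (seq i)) ∧
    seq 0 = P ∧
    seq (Fin.last n) = {Finset.univ} ∧
    (∀ i : Fin n, MergeStep (seq i.castSucc) (seq i.succ)) ∧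
    ∀ i, ∀ B ∈ seq i, redDeg le (seq i) B ≤ d

theorem GoodFrom.prepend {X : Type*} [Fintype X] [DecidableEq X] {le : X → X → Prop} {d : ℕ}
    {P Q : Finset (Finset X)} (hP : IsPartitionOf P) (hd : ∀ B ∈ P, redDeg le P B ≤ d)
    (hm : MergeStep P Q) (hQ : GoodFrom le d Q) : GoodFrom le d P := by
  obtain ⟨n, seq, h1, h2, h3, h4, h5⟩ := hQ
  refine ⟨n + 1, Fin.cons P seq, ?_, rfl, ?_, ?_, ?_⟩
  · intro i
    refine Fin.cases ?_ (fun i => ?_) i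
    · exact hP
    · exact h1 i
  · rw [← Fin.succ_last]; exact h3
  · intro i
    refine Fin.cases ?_ (fun i => ?_) i
    · have : MergeStep P (seq 0) := by rw [h2]; exact hm
      exact this
    · exact h4 i
  · intro i
    refine Fin.cases ?_ (fun i => ?_) i
    · exact hd
    · exact h5 i

theorem redDeg_le_card {X : Type*} [DecidableEq X] (le : X → X → Prop)
    (P : Finset (Finset X)) (B : Finset X) (hB : B ∈ P) : redDeg le P B ≤ P.card - 1 := by
  classical
  unfold redDeg
  rw [← Finset.card_erase_of_mem hB]
  apply Finset.card_le_card
  intro C hC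
  simp only [Finset.mem_filter] at hC
  exact Finset.mem_erase.2 ⟨hC.2.1, hC.1⟩

theorem part_eq {X : Type*} {P : Finset (Finset X)} (hP : IsPartitionOf P)
    {B C : Finset X} (hB : B ∈ P) (hC : C ∈ P) {x : X} (hxB : x ∈ B) (hxC : x ∈ C) : B = C :=
  (hP.2 x).unique ⟨hB, hxB⟩ ⟨hC, hxC⟩

theorem merge_partition {X : Type*} [DecidableEq X] {P : Finset (Finset X)}
    (hP : IsPartitionOf P) {B C : Finset X} (hB : B ∈ P) (hC : C ∈ P) :
    IsPartitionOf (insert (B ∪ C) ((P.erase B).erase C)) := by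
  constructor
  · intro D hD
    rcases Finset.mem_insert.1 hD with rfl | hD
    · exact (hP.1 B hB).mono Finset.subset_union_left
    · exact hP.1 D (Finset.mem_of_mem_erase (Finset.mem_of_mem_erase hD))
  · intro x
    by_cases hx : x ∈ B ∪ C
    · refine ⟨B ∪ C, ⟨Finset.mem_insert_self _ _, hx⟩, ?_⟩
      rintro D ⟨hD, hxD⟩
      rcases Finset.mem_insert.1 hD with rfl | hD
      · rfl
      · exfalso
        simp only [Finset.mem_erase] at hD
        rcases Finset.mem_union.1 hx with h | h
        · exact hD.2.1 (part_eq hP hD.2.2 hB hxD h)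
        · exact hD.1 (part_eq hP hD.2.2 hC hxD h)
    · obtain ⟨D, ⟨hD, hxD⟩, hu⟩ := hP.2 x
      rw [Finset.mem_union, not_or] at hx
      refine ⟨D, ⟨?_, hxD⟩, ?_⟩
      · refine Finset.mem_insert_of_mem (Finset.mem_erase.2 ⟨?_, Finset.mem_erase.2 ⟨?_, hD⟩⟩)
        · rintro rfl; exact hx.2 hxD
        · rintro rfl; exact hx.1 hxD
      · rintro E ⟨hE, hxE⟩
        rcases Finset.mem_insert.1 hE with rfl | hE
        · exact absurd hxE (by simp [hx.1, hx.2])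
        · exact hu E ⟨Finset.mem_of_mem_erase (Finset.mem_of_mem_erase hE), hxE⟩

theorem good_of_small {X : Type*} [Fintype X] [DecidableEq X] [Nonempty X]
    (le : X → X → Prop) (d : ℕ) : ∀ (n : ℕ) (P : Finset (Finset X)), P.card = n →
      IsPartitionOf P → P.card ≤ d + 1 → GoodFrom le d P := by
  intro n
  induction n with
  | zero =>
    intro P hn hP _
    obtain ⟨B, hB, -⟩ := hP.2 (Classical.arbitrary X)
    rw [Finset.card_eq_zero] at hn
    rw [hn] at hB
    exact absurd hB.1 (Finset.notMem_empty _)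
  | succ n ih =>
    intro P hn hP hle
    have hdeg : ∀ B ∈ P, redDeg le P B ≤ d := fun B hB =>
      (redDeg_le_card le P B hB).trans (by omega)
    rcases Nat.eq_zero_or_pos n with rfl | hpos
    · obtain ⟨B, hB⟩ := Finset.card_eq_one.1 hn
      have hBu : B = Finset.univ := by
        ext x
        obtain ⟨C, ⟨hC, hx⟩, -⟩ := hP.2 x
        rw [hB, Finset.mem_singleton] at hC
        simp [← hC, hx]
      refine ⟨0, fun _ => P, fun _ => hP, rfl, by rw [hB, hBu], fun i => i.elim0, fun _ => hdeg⟩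
    · obtain ⟨B, hB, C, hC, hne⟩ := Finset.one_lt_card.1 (by omega : 1 < P.card)
      have hnot : B ∪ C ∉ (P.erase B).erase C := by
        intro h
        simp only [Finset.mem_erase] at h
        obtain ⟨x, hx⟩ := hP.1 B hB
        exact h.2.1 (part_eq hP h.2.2 hB (Finset.mem_union_left _ hx) hx)
      have hcard : (insert (B ∪ C) ((P.erase B).erase C)).card = n := by
        rw [Finset.card_insert_of_notMem hnot,
          Finset.card_erase_of_mem (Finset.mem_erase.2 ⟨hne.symm, hC⟩),
          Finset.card_erase_of_mem hB]
        omega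
      exact GoodFrom.prepend hP hdeg ⟨B, hB, C, hC, hne, rfl⟩
        (ih _ hcard (merge_partition hP hB hC) (by omega))

/-! ### Interval partitions of chains given by cuts -/

section Cuts

set_option linter.unusedSectionVars false

variable {X : Type*} [PartialOrder X] [Fintype X] [DecidableEq X]

/-- `x` and `y` are on the same chain, and no cut of `T` separates them. -/
def CutEqv (c : X → ℕ) (T : Finset X) (x y : X) : Prop :=
  c x = c y ∧ ∀ t ∈ T, c t = c x → (t ≤ x ↔ t ≤ y)

theorem CutEqv.refl_ {c : X → ℕ} {T : Finset X} {x : X} : CutEqv c T x x :=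
  ⟨rfl, fun _ _ _ => Iff.rfl⟩

theorem CutEqv.symm_ {c : X → ℕ} {T : Finset X} {x y : X} (h : CutEqv c T x y) :
    CutEqv c T y x :=
  ⟨h.1.symm, fun t ht hc => (h.2 t ht (hc.trans h.1.symm)).symm⟩

theorem CutEqv.trans_ {c : X → ℕ} {T : Finset X} {x y z : X} (h : CutEqv c T x y)
    (h' : CutEqv c T y z) : CutEqv c T x z :=
  ⟨h.1.trans h'.1, fun t ht hc => (h.2 t ht hc).trans (h'.2 t ht (hc.trans h.1))⟩

theorem CutEqv.mono {c : X → ℕ} {T T' : Finset X} (hT : T' ⊆ T) {x y : X}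
    (h : CutEqv c T x y) : CutEqv c T' x y :=
  ⟨h.1, fun t ht hc => h.2 t (hT ht) hc⟩

open Classical in
/-- The part of `x`. -/
noncomputable def cutCls (c : X → ℕ) (T : Finset X) (x : X) : Finset X :=
  Finset.univ.filter (CutEqv c T x)

theorem mem_cutCls {c : X → ℕ} {T : Finset X} {x y : X} :
    y ∈ cutCls c T x ↔ CutEqv c T x y := by
  simp [cutCls]

theorem cutCls_eq {c : X → ℕ} {T : Finset X} {x y : X} (h : CutEqv c T x y) :
    cutCls c T x = cutCls c T y := by
  ext z
  rw [mem_cutCls, mem_cutCls]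
  exact ⟨fun h' => h.symm_.trans_ h', fun h' => h.trans_ h'⟩

theorem cutCls_eq_iff {c : X → ℕ} {T : Finset X} {x y : X} :
    cutCls c T x = cutCls c T y ↔ CutEqv c T x y := by
  refine ⟨fun h => ?_, cutCls_eq⟩
  have : y ∈ cutCls c T x := by rw [h, mem_cutCls]; exact CutEqv.refl_
  exact mem_cutCls.1 this

/-- The partition determined by the cuts. -/
noncomputable def cutPart (c : X → ℕ) (T : Finset X) : Finset (Finset X) :=
  Finset.univ.image (cutCls c T)

theorem mem_cutPart {c : X → ℕ} {T : Finset X} {B : Finset X} :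
    B ∈ cutPart c T ↔ ∃ x, cutCls c T x = B := by
  simp [cutPart]

theorem cutPart_isPartition (c : X → ℕ) (T : Finset X) : IsPartitionOf (cutPart c T) := by
  constructor
  · intro B hB
    obtain ⟨x, rfl⟩ := mem_cutPart.1 hB
    exact ⟨x, mem_cutCls.2 CutEqv.refl_⟩
  · intro x
    refine ⟨cutCls c T x, ⟨mem_cutPart.2 ⟨x, rfl⟩, mem_cutCls.2 CutEqv.refl_⟩, ?_⟩
    rintro B ⟨hB, hx⟩
    obtain ⟨y, rfl⟩ := mem_cutPart.1 hB
    exact cutCls_eq (mem_cutCls.1 hx)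

/-- A predecessor within the chain. -/
theorem exists_pred {c : X → ℕ} (hch : ∀ x y, c x = c y → x ≤ y ∨ y ≤ x) {t : X}
    (ht : ∃ s, c s = c t ∧ s < t) :
    ∃ s, c s = c t ∧ s < t ∧ ∀ x, c x = c t → x < t → x ≤ s := by
  classical
  let W : Finset X := Finset.univ.filter fun s => c s = c t ∧ s < t
  have hW : W.Nonempty := by
    obtain ⟨s, hs⟩ := ht
    exact ⟨s, by simp [W, hs]⟩
  obtain ⟨s, hs⟩ := W.exists_maximal hW
  have hs1 : c s = c t ∧ s < t := by simpa [W] using hs.1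
  refine ⟨s, hs1.1, hs1.2, fun x hx hxt => ?_⟩
  rcases hch x s (hx.trans hs1.1.symm) with h | h
  · exact h
  · exact hs.2 (by simp [W, hx, hxt]) h

theorem cutCls_erase {c : X → ℕ} (hch : ∀ x y, c x = c y → x ≤ y ∨ y ≤ x) {T : Finset X}
    {t : X} {x : X} (hx : ¬ CutEqv c (T.erase t) x t) :
    cutCls c (T.erase t) x = cutCls c T x := by
  ext y
  rw [mem_cutCls, mem_cutCls]
  refine ⟨fun h => ⟨h.1, fun t' ht' hc => ?_⟩, CutEqv.mono (Finset.erase_subset _ _)⟩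
  by_cases htt : t' = t
  swap
  · exact h.2 t' (Finset.mem_erase.2 ⟨htt, ht'⟩) hc
  subst htt
  constructor
  · intro hle
    by_contra hn
    have hyt : y ≤ t' := (hch y t' (h.1.symm.trans hc.symm)).resolve_right hn
    apply hx
    refine ⟨hc.symm, fun u hu huc => ⟨fun hux => ?_, fun hut => hut.trans hle⟩⟩
    exact ((h.2 u hu huc).1 hux).trans hyt
  · intro hle
    by_contra hn
    have hyt : x ≤ t' := (hch x t' hc.symm).resolve_right hn
    apply hx
    refine ⟨hc.symm, fun u hu huc => ⟨fun hux => hux.trans hyt, fun hut => ?_⟩⟩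
    exact (h.2 u hu huc).2 (hut.trans hle)

theorem cut_step {c : X → ℕ} (hch : ∀ x y, c x = c y → x ≤ y ∨ y ≤ x) {T : Finset X}
    {t : X} (htT : t ∈ T) (ht : ∃ s, c s = c t ∧ s < t) :
    MergeStep (cutPart c T) (cutPart c (T.erase t)) := by
  obtain ⟨s, hsc, hst, hs⟩ := exists_pred hch ht
  have hnot : ¬ CutEqv c T s t := fun h =>
    absurd ((h.2 t htT hsc.symm).2 le_rfl) hst.not_ge
  have hst' : CutEqv c (T.erase t) s t := by
    refine ⟨hsc, fun u hu huc => ⟨fun h => h.trans hst.le, fun h => ?_⟩⟩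
    exact hs u (huc.trans hsc) (lt_of_le_of_ne h (Finset.mem_erase.1 hu).1)
  have hiff : ∀ x, CutEqv c (T.erase t) t x ↔ CutEqv c T s x ∨ CutEqv c T t x := by
    intro x
    constructor
    · intro h
      by_cases htx : t ≤ x
      · right
        refine ⟨h.1, fun u hu huc => ?_⟩
        by_cases hut : u = t
        · subst hut; simp [htx]
        · exact h.2 u (Finset.mem_erase.2 ⟨hut, hu⟩) huc
      · left
        refine ⟨hsc.trans h.1, fun u hu huc => ?_⟩
        by_cases hut : u = t
        · subst hut
          simp [htx, hst.not_ge]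
        · exact (hst'.trans_ h).2 u (Finset.mem_erase.2 ⟨hut, hu⟩) huc
    · rintro (h | h)
      · exact hst'.symm_.trans_ (h.mono (Finset.erase_subset _ _))
      · exact h.mono (Finset.erase_subset _ _)
  have hun : cutCls c (T.erase t) t = cutCls c T s ∪ cutCls c T t := by
    ext x
    rw [Finset.mem_union, mem_cutCls, mem_cutCls, mem_cutCls, hiff]
  refine ⟨cutCls c T s, mem_cutPart.2 ⟨s, rfl⟩, cutCls c T t, mem_cutPart.2 ⟨t, rfl⟩, ?_, ?_⟩
  · rw [Ne, cutCls_eq_iff]; exact hnot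
  · rw [← hun]
    ext B
    rw [Finset.mem_insert, Finset.mem_erase, Finset.mem_erase, mem_cutPart, mem_cutPart]
    constructor
    · rintro ⟨x, rfl⟩
      by_cases hx : CutEqv c (T.erase t) x t
      · exact Or.inl (cutCls_eq hx)
      · right
        rw [cutCls_erase hch hx]
        refine ⟨?_, ?_, x, rfl⟩
        · rw [Ne, cutCls_eq_iff]
          exact fun h => hx (h.mono (Finset.erase_subset _ _))
        · rw [Ne, cutCls_eq_iff]
          exact fun h => hx ((h.mono (Finset.erase_subset _ _)).trans_ hst')
    · rintro (rfl | ⟨h1, h2, x, rfl⟩)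
      · exact ⟨t, rfl⟩
      · refine ⟨x, cutCls_erase hch ?_⟩
        intro h
        rw [Ne, cutCls_eq_iff] at h1 h2
        rcases (hiff x).1 h.symm_ with hsx | htx
        · exact h2 hsx.symm_
        · exact h1 htx.symm_

/-! ### Cuts strictly inside the shadow of a part -/

/-- The cut `p` lies strictly inside the shadow of `M` on the chain of `p`. -/
def InShadow (c : X → ℕ) (R : X → X → Prop) (p : X) (M : Finset X) : Prop :=
  (∃ q, c q = c p ∧ q < p ∧ ∃ y ∈ M, R y q) ∧ ∃ y ∈ M, ¬ R y p

/-- A relation compatible with the order. -/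
def OrdComp (R : X → X → Prop) : Prop :=
  ∀ y' y x x', y' ≤ y → x ≤ x' → R y x → R y' x'

open Classical in
/-- The number of cuts inside the shadow. -/
noncomputable def shadowCount (c : X → ℕ) (R : X → X → Prop) (T : Finset X) (i : ℕ)
    (M : Finset X) : ℕ :=
  (T.filter fun p => c p ≠ i ∧ InShadow c R p M).card

theorem three_false {c : X → ℕ} (hch : ∀ x y, c x = c y → x ≤ y ∨ y ≤ x) {R : X → X → Prop}
    (hR : OrdComp R) {T : Finset X} {p t₁ t₂ t₃ : X} (h2 : t₂ ∈ T)
    (hc12 : c t₁ = c t₂) (hc23 : c t₂ = c t₃) (h12 : t₁ < t₂) (h23 : t₂ < t₃)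
    (hp1 : InShadow c R p (cutCls c (T.erase t₁) t₁))
    (hp3 : InShadow c R p (cutCls c (T.erase t₃) t₃)) : False := by
  obtain ⟨-, y', hy', hRy'⟩ := hp1
  obtain ⟨⟨q, -, hqp, y, hy, hRy⟩, -⟩ := hp3
  rw [mem_cutCls] at hy hy'
  apply hRy'
  refine hR y' y q p ?_ hqp.le hRy
  have hy2 : t₂ ≤ y := (hy.2 t₂ (Finset.mem_erase.2 ⟨h23.ne, h2⟩) hc23).1 h23.le
  have hy2' : ¬ t₂ ≤ y' := fun h => absurd
    ((hy'.2 t₂ (Finset.mem_erase.2 ⟨h12.ne', h2⟩) hc12.symm).2 h) h12.not_ge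
  exact ((hch y' t₂ (hy'.1.symm.trans hc12)).resolve_right hy2').trans hy2

theorem three_false' {c : X → ℕ} (hch : ∀ x y, c x = c y → x ≤ y ∨ y ≤ x) {R : X → X → Prop}
    (hR : OrdComp R) {T : Finset X} {p : X} {i : ℕ} (W : Finset X)
    (hW : ∀ t ∈ W, t ∈ T ∧ c t = i ∧ InShadow c R p (cutCls c (T.erase t) t)) :
    W.card ≤ 2 := by
  by_contra hcon
  push Not at hcon
  obtain ⟨a, ha, b, hb, e, he, hab, hae, hbe⟩ := Finset.two_lt_card.1 hcon
  have lt : ∀ x ∈ W, ∀ y ∈ W, x ≠ y → x < y ∨ y < x := by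
    intro x hx y hy hne
    rcases hch x y ((hW x hx).2.1.trans (hW y hy).2.1.symm) with h | h
    · exact Or.inl (lt_of_le_of_ne h hne)
    · exact Or.inr (lt_of_le_of_ne h hne.symm)
  have key : ∀ x ∈ W, ∀ y ∈ W, ∀ z ∈ W, x < y → y < z → False := by
    intro x hx y hy z hz hxy hyz
    exact three_false hch hR (hW y hy).1 ((hW x hx).2.1.trans (hW y hy).2.1.symm)
      ((hW y hy).2.1.trans (hW z hz).2.1.symm) hxy hyz (hW x hx).2.2 (hW z hz).2.2
  rcases lt a ha b hb hab with h1 | h1 <;> rcases lt a ha e he hae with h2 | h2 <;>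
    rcases lt b hb e he hbe with h3 | h3
  · exact key a ha b hb e he h1 h3
  · exact key a ha e he b hb h2 h3
  · exact key a ha b hb e he h1 h3
  · exact key e he a ha b hb h2 h1
  · exact key b hb a ha e he h1 h2
  · exact key a ha e he b hb h2 h3
  · exact key b hb e he a ha h3 h2
  · exact key e he b hb a ha h3 h1

theorem sum_shadow {c : X → ℕ} (hch : ∀ x y, c x = c y → x ≤ y ∨ y ≤ x) {d : ℕ}
    (hcd : ∀ x, c x < d) {R : X → X → Prop} (hR : OrdComp R) (T : Finset X) :
    ∑ t ∈ T, shadowCount c R T (c t) (cutCls c (T.erase t) t) ≤ T.card * (2 * (d - 1)) := by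
  classical
  unfold shadowCount
  refine le_of_eq_of_le (Finset.sum_card_bipartiteAbove_eq_sum_card_bipartiteBelow
    (fun t p => c p ≠ c t ∧ InShadow c R p (cutCls c (T.erase t) t)) (s := T) (t := T)) ?_
  rw [← smul_eq_mul]
  apply Finset.sum_le_card_nsmul
  intro p _
  have := Finset.card_le_mul_card_image_of_maps_to
    (s := T.bipartiteBelow (fun t p => c p ≠ c t ∧ InShadow c R p (cutCls c (T.erase t) t)) p)
    (t := (Finset.range d).erase (c p)) (f := c) ?_ 2 ?_
  · rwa [Finset.card_erase_of_mem (Finset.mem_range.2 (hcd p)), Finset.card_range] at this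
  · intro t ht
    rw [Finset.mem_bipartiteBelow] at ht
    exact Finset.mem_erase.2 ⟨ht.2.1.symm, Finset.mem_range.2 (hcd t)⟩
  · intro i _
    apply three_false' hch hR (T := T) (p := p) (i := i)
    intro t ht
    rw [Finset.mem_filter, Finset.mem_bipartiteBelow] at ht
    exact ⟨ht.1.1, ht.2, ht.1.2.2⟩

/-- The part `B` is mixed with respect to `C`. -/
def Mixed (R : X → X → Prop) (B C : Finset X) : Prop :=
  (∃ x ∈ B, ∃ y ∈ C, R y x) ∧ ∃ x ∈ B, ∃ y ∈ C, ¬ R y x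

theorem exists_cls_min {c : X → ℕ} (hch : ∀ x y, c x = c y → x ≤ y ∨ y ≤ x) (T : Finset X)
    (x : X) : ∃ z, CutEqv c T x z ∧ ∀ y, CutEqv c T z y → z ≤ y := by
  obtain ⟨z, hz⟩ := (cutCls c T x).exists_minimal ⟨x, mem_cutCls.2 CutEqv.refl_⟩
  have hxz := mem_cutCls.1 hz.1
  refine ⟨z, hxz, fun y hy => ?_⟩
  rcases hch z y hy.1 with h | h
  · exact h
  · exact hz.2 (mem_cutCls.2 (hxz.trans_ hy)) h

theorem min_mem_cut {c : X → ℕ} (hch : ∀ x y, c x = c y → x ≤ y ∨ y ≤ x) {T : Finset X}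
    {z : X} (hz : ∀ y, CutEqv c T z y → z ≤ y) (hp : ∃ s, c s = c z ∧ s < z) : z ∈ T := by
  by_contra hn
  obtain ⟨s, hsc, hsz, hs⟩ := exists_pred hch hp
  refine absurd (hz s ⟨hsc.symm, fun u hu huc => ⟨fun h => ?_, fun h => h.trans hsz.le⟩⟩)
    hsz.not_ge
  exact hs u huc (lt_of_le_of_ne h (by rintro rfl; exact hn hu))

open Classical in
theorem mixed_count {c : X → ℕ} (hch : ∀ x y, c x = c y → x ≤ y ∨ y ≤ x) {d : ℕ}
    (hcd : ∀ x, c x < d) {R : X → X → Prop} (hR : OrdComp R) (T : Finset X) (x : X) :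
    ((cutPart c T).filter fun B => (∃ z ∈ B, c z ≠ c x) ∧ Mixed R B (cutCls c T x)).card ≤
      shadowCount c R T (c x) (cutCls c T x) + (d - 1) := by
  let S : Finset X := Finset.univ.filter fun z => (∀ y, CutEqv c T z y → z ≤ y) ∧ c z ≠ c x ∧
    Mixed R (cutCls c T z) (cutCls c T x)
  let L : Finset X := S.filter fun z => ∀ z' ∈ S, c z' = c z → z ≤ z'
  have h1 : ((cutPart c T).filter fun B => (∃ z ∈ B, c z ≠ c x) ∧
      Mixed R B (cutCls c T x)).card ≤ S.card := by
    refine (Finset.card_le_card ?_).trans (Finset.card_image_le (s := S) (f := cutCls c T))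
    intro B hB
    obtain ⟨hB, ⟨w, hw, hwc⟩, hm⟩ := Finset.mem_filter.1 hB
    obtain ⟨b, rfl⟩ := mem_cutPart.1 hB
    obtain ⟨z, hbz, hz⟩ := exists_cls_min hch T b
    have hw' := mem_cutCls.1 hw
    refine Finset.mem_image.2 ⟨z, ?_, (cutCls_eq hbz).symm⟩
    simp only [S, Finset.mem_filter, Finset.mem_univ, true_and]
    refine ⟨hz, ?_, ?_⟩
    · rw [← hbz.1, hw'.1]; exact hwc
    · rw [← cutCls_eq hbz]; exact hm
  have h2 : L.card ≤ d - 1 := by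
    have : L.card ≤ ((Finset.range d).erase (c x)).card := by
      apply Finset.card_le_card_of_injOn c
      · intro z hz
        have hzS := (Finset.mem_filter.1 hz).1
        simp only [S, Finset.mem_filter, Finset.mem_univ, true_and] at hzS
        exact Finset.mem_erase.2 ⟨hzS.2.1, Finset.mem_range.2 (hcd z)⟩
      · intro z hz z' hz' h
        have a := Finset.mem_filter.1 hz
        have b := Finset.mem_filter.1 hz'
        exact le_antisymm (a.2 z' b.1 h.symm) (b.2 z a.1 h)
    rwa [Finset.card_erase_of_mem (Finset.mem_range.2 (hcd x)), Finset.card_range] at this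
  have h3 : S ⊆ (T.filter fun p => c p ≠ c x ∧ InShadow c R p (cutCls c T x)) ∪ L := by
    intro z hz
    rw [Finset.mem_union]
    by_cases hL : z ∈ L
    · exact Or.inr hL
    left
    have : ∃ z' ∈ S, c z' = c z ∧ ¬ z ≤ z' := by
      by_contra hcon
      push Not at hcon
      exact hL (Finset.mem_filter.2 ⟨hz, hcon⟩)
    obtain ⟨z', hz', hcc, hnle⟩ := this
    have hlt : z' < z := lt_of_le_of_ne ((hch z' z hcc).resolve_right hnle)
      (by rintro rfl; exact hnle le_rfl)
    simp only [S, Finset.mem_filter, Finset.mem_univ, true_and] at hz hz'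
    obtain ⟨hzmin, hzc, hzm⟩ := hz
    obtain ⟨-, -, hzm'⟩ := hz'
    have hzT : z ∈ T := min_mem_cut hch hzmin ⟨z', hcc, hlt⟩
    refine Finset.mem_filter.2 ⟨hzT, hzc, ?_, ?_⟩
    · obtain ⟨⟨w, hw, y, hy, hRy⟩, -⟩ := hzm'
      have hw' := mem_cutCls.1 hw
      have hwz : ¬ z ≤ w := fun h => hnle ((hw'.2 z hzT hcc.symm).2 h)
      have hcw : c w = c z := hw'.1.symm.trans hcc
      refine ⟨w, hcw, ?_, y, hy, hRy⟩
      exact lt_of_le_of_ne ((hch w z hcw).resolve_right hwz)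
        (by rintro rfl; exact hwz le_rfl)
    · obtain ⟨-, w, hw, y, hy, hRy⟩ := hzm
      exact ⟨y, hy, fun h => hRy (hR y y z w le_rfl (hzmin w (mem_cutCls.1 hw)) h)⟩
  have h4 := (Finset.card_le_card h3).trans (Finset.card_union_le _ _)
  unfold shadowCount
  omega

theorem ordComp_le : OrdComp (fun y x : X => y ≤ x) :=
  fun _ _ _ _ h1 h2 h => (h1.trans h).trans h2

theorem ordComp_not_ge : OrdComp (fun y x : X => ¬ x ≤ y) :=
  fun _ _ _ _ h1 h2 h h' => h ((h2.trans h').trans h1)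

/-- The total number of cuts in the two shadows. -/
noncomputable def shadowTotal (c : X → ℕ) (T : Finset X) (i : ℕ) (M : Finset X) : ℕ :=
  shadowCount c (fun y x => y ≤ x) T i M + shadowCount c (fun y x => ¬ x ≤ y) T i M

/-- Different parts on the same chain are comparable. -/
theorem same_chain {c : X → ℕ} (hch : ∀ x y, c x = c y → x ≤ y ∨ y ≤ x) {T : Finset X}
    {x y t : X} (hxy : c x = c y) (ht : t ∈ T) (htc : c t = c x) (h1 : t ≤ x) (h2 : ¬ t ≤ y) :
    blockLE (· ≤ ·) (cutCls c T y) (cutCls c T x) := by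
  intro v hv u hu
  rw [mem_cutCls] at hu hv
  have hu' := (hu.2 t ht htc).1 h1
  have hv' : ¬ t ≤ v := fun h => h2 ((hv.2 t ht (htc.trans hxy)).2 h)
  exact ((hch v t (hv.1.symm.trans (hxy.symm.trans htc.symm))).resolve_right hv').trans hu'

theorem redDeg_bound {c : X → ℕ} (hch : ∀ x y, c x = c y → x ≤ y ∨ y ≤ x) {d : ℕ}
    (hcd : ∀ x, c x < d) (T : Finset X) (x : X) :
    redDeg (· ≤ ·) (cutPart c T) (cutCls c T x) ≤
      shadowTotal c T (c x) (cutCls c T x) + 2 * (d - 1) := by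
  classical
  have h1 := mixed_count hch hcd ordComp_le T x
  have h2 := mixed_count hch hcd ordComp_not_ge T x
  unfold redDeg shadowTotal
  refine (Finset.card_le_card (t := ((cutPart c T).filter fun B => (∃ z ∈ B, c z ≠ c x) ∧
      Mixed (fun y x => y ≤ x) B (cutCls c T x)) ∪ ((cutPart c T).filter fun B =>
      (∃ z ∈ B, c z ≠ c x) ∧ Mixed (fun y x => ¬ x ≤ y) B (cutCls c T x))) ?_).trans
    ((Finset.card_union_le _ _).trans (by omega))
  intro B hB
  simp only [Finset.mem_filter] at hB
  obtain ⟨hB, hne, hr1, hr2, u, hu, v, hv, huv⟩ := hB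
  have hcol : ∃ z ∈ B, c z ≠ c x := by
    obtain ⟨b, rfl⟩ := mem_cutPart.1 hB
    refine ⟨b, mem_cutCls.2 CutEqv.refl_, fun hbc => ?_⟩
    rw [Ne, cutCls_eq_iff] at hne
    apply hne
    refine ⟨hbc, fun t ht htc => ⟨fun h => ?_, fun h => ?_⟩⟩
    · by_contra hn
      exact hr1 (same_chain hch hbc ht htc h hn)
    · by_contra hn
      exact hr2 (same_chain hch hbc.symm ht (htc.trans hbc) h hn)
  simp only [blockLE, not_forall] at hr1 hr2
  obtain ⟨p, hp, q, hq, hpq⟩ := hr1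
  obtain ⟨r, hr, s, hs, hrs⟩ := hr2
  rw [Finset.mem_union, Finset.mem_filter, Finset.mem_filter]
  rcases huv with h | h
  · exact Or.inl ⟨hB, hcol, ⟨v, hv, u, hu, h⟩, ⟨q, hq, p, hp, hpq⟩⟩
  · exact Or.inr ⟨hB, hcol, ⟨r, hr, s, hs, hrs⟩, ⟨v, hv, u, hu, not_not.2 h⟩⟩

theorem exists_cheap {c : X → ℕ} (hch : ∀ x y, c x = c y → x ≤ y ∨ y ≤ x) {d : ℕ}
    (hcd : ∀ x, c x < d) (T : Finset X) (hT : T.Nonempty) :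
    ∃ t ∈ T, shadowTotal c T (c t) (cutCls c (T.erase t) t) ≤ 4 * (d - 1) := by
  have h1 := sum_shadow hch hcd ordComp_le T
  have h2 := sum_shadow hch hcd ordComp_not_ge T
  apply Finset.exists_le_of_sum_le hT
  unfold shadowTotal
  rw [Finset.sum_add_distrib, Finset.sum_const, smul_eq_mul]
  refine (Nat.add_le_add h1 h2).trans (le_of_eq ?_)
  ring

theorem shadowTotal_mono (c : X → ℕ) {T T' : Finset X} (h : T' ⊆ T) (i : ℕ) (M : Finset X) :
    shadowTotal c T' i M ≤ shadowTotal c T i M := by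
  unfold shadowTotal shadowCount
  refine Nat.add_le_add (Finset.card_le_card ?_) (Finset.card_le_card ?_) <;>
  · intro p
    simp only [Finset.mem_filter]
    exact fun hp => ⟨h hp.1, hp.2⟩

theorem good_cut [Nonempty X] {c : X → ℕ} (hch : ∀ x y, c x = c y → x ≤ y ∨ y ≤ x) {d : ℕ}
    (hcd : ∀ x, c x < d) : ∀ (n : ℕ) (T : Finset X), T.card = n →
      (∀ t ∈ T, ∃ s, c s = c t ∧ s < t) →
      (∀ x, shadowTotal c T (c x) (cutCls c T x) ≤ 4 * (d - 1)) →
      GoodFrom (· ≤ ·) (6 * (d - 1)) (cutPart c T) := by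
  intro n
  induction n with
  | zero =>
    intro T hn _ _
    rw [Finset.card_eq_zero] at hn
    subst hn
    apply good_of_small _ _ _ _ rfl (cutPart_isPartition c ∅)
    have : (cutPart c (∅ : Finset X)).card ≤ d := by
      have hsub : cutPart c (∅ : Finset X) ⊆
          (Finset.range d).image fun i => Finset.univ.filter fun x => i = c x := by
        intro B hB
        obtain ⟨x, rfl⟩ := mem_cutPart.1 hB
        refine Finset.mem_image.2 ⟨c x, Finset.mem_range.2 (hcd x), ?_⟩
        ext y
        rw [mem_cutCls]
        simp [CutEqv]
      exact (Finset.card_le_card hsub).trans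
        (Finset.card_image_le.trans (Finset.card_range d).le)
    omega
  | succ n ih =>
    intro T hn hT hsh
    obtain ⟨t, ht, hle⟩ := exists_cheap hch hcd T (Finset.card_pos.1 (by omega))
    refine GoodFrom.prepend (cutPart_isPartition c T) ?_ (cut_step hch ht (hT t ht))
      (ih (T.erase t) ?_ ?_ ?_)
    · intro B hB
      obtain ⟨x, rfl⟩ := mem_cutPart.1 hB
      have := redDeg_bound hch hcd T x
      have := hsh x
      omega
    · rw [Finset.card_erase_of_mem ht]; omega
    · exact fun u hu => hT u (Finset.mem_of_mem_erase hu)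
    · intro x
      refine (shadowTotal_mono c (Finset.erase_subset t T) _ _).trans ?_
      by_cases hx : CutEqv c (T.erase t) x t
      · rw [cutCls_eq hx, hx.1]; exact hle
      · rw [cutCls_erase hch hx]; exact hsh x

end Cuts

/-- Every finite poset of width `d` (maximum antichain size `d`)
has natural twin-width at most `9d − 6`. -/
theorem stmt7 {X : Type*} [PartialOrder X] [Fintype X] [DecidableEq X] [Nonempty X]
    (d : ℕ)
    (hub : ∀ A : Finset X, IsAntichain (· ≤ ·) (A : Set X) → A.card ≤ d)
    (hex : ∃ A : Finset X, IsAntichain (· ≤ ·) (A : Set X) ∧ A.card = d) :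
    NatTwinWidthLE (· ≤ ·) (X := X) (9 * d - 6) := by
  classical
  obtain ⟨c, A, -, hA, hcA, hchA⟩ := dilworth_aux (Finset.univ : Finset X)
  have hch : ∀ x y : X, c x = c y → x ≤ y ∨ y ≤ x := fun x y =>
    hchA x (Finset.mem_univ _) y (Finset.mem_univ _)
  have hcd : ∀ x, c x < d := fun x => (hcA x (Finset.mem_univ _)).trans_le (hub A hA)
  let T : Finset X := Finset.univ.filter fun t => ∃ s, c s = c t ∧ s < t
  have hT : ∀ t ∈ T, ∃ s, c s = c t ∧ s < t := fun t ht => (Finset.mem_filter.1 ht).2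
  have hcls : ∀ x, cutCls c T x = {x} := by
    intro x
    ext y
    rw [mem_cutCls, Finset.mem_singleton]
    constructor
    · intro h
      by_contra hne
      rcases hch x y h.1 with hle | hle
      · have hlt : x < y := lt_of_le_of_ne hle (Ne.symm hne)
        have hy : y ∈ T := Finset.mem_filter.2 ⟨Finset.mem_univ _, x, h.1, hlt⟩
        exact hlt.not_ge ((h.2 y hy h.1.symm).2 le_rfl)
      · have hlt : y < x := lt_of_le_of_ne hle hne
        have hx : x ∈ T := Finset.mem_filter.2 ⟨Finset.mem_univ _, y, h.1.symm, hlt⟩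
        exact hlt.not_ge ((h.2 x hx rfl).1 le_rfl)
    · rintro rfl; exact CutEqv.refl_
  have hzero : ∀ R : X → X → Prop, OrdComp R → ∀ x, shadowCount c R T (c x) {x} = 0 := by
    intro R hR x
    unfold shadowCount
    rw [Finset.card_eq_zero, Finset.filter_eq_empty_iff]
    rintro p - ⟨-, ⟨q, -, hqp, y, hy, hRy⟩, y', hy', hRy'⟩
    rw [Finset.mem_singleton] at hy hy'
    subst hy hy'
    exact hRy' (hR _ _ _ _ le_rfl hqp.le hRy)
  have hgood := good_cut hch hcd T.card T rfl hT (by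
    intro x
    rw [hcls x]
    unfold shadowTotal
    rw [hzero _ ordComp_le, hzero _ ordComp_not_ge]
    omega)
  obtain ⟨n, seq, h1, h2, h3, h4, h5⟩ := hgood
  refine ⟨n, seq, h1, ?_, h3, h4, fun i B hB => (h5 i B hB).trans (by omega)⟩
  rw [h2]
  unfold cutPart
  congr 1
  funext x
  exact hcls x
end

section
/- Every finite poset of width 2 has natural twin-width at most 2. -/
/-- Existence of the zigzag level function on a finite set. -/
lemma exists_lev_aux {X : Type*} [PartialOrder X] [DecidableEq X]
    (hw : ∀ x y z : X, (x ≤ y ∨ y ≤ x) ∨ (y ≤ z ∨ z ≤ y) ∨ (x ≤ z ∨ z ≤ x)) (n : ℕ) :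
    ∀ (U C : Finset X) (c : X), U.card ≤ n → C ⊆ U → c ∈ C → (∀ x ∈ C, c ≤ x) →
      (∀ x ∈ C, ∀ y ∈ C, x ≤ y ∨ y ≤ x) → (∀ x ∈ U, x ∉ C → ¬ c ≤ x) →
      ∃ lev : X → ℕ, (∀ x ∈ U, lev x = 0 ↔ x ∈ C) ∧
        (∀ x ∈ U, ∀ y ∈ U, lev x = lev y → x ≤ y ∨ y ≤ x) ∧
        (∀ x ∈ U, ∀ y ∈ U, lev x + 2 ≤ lev y → y ≤ x) ∧
        (∀ x ∈ U, ∀ y ∈ U, x ≤ y → lev y ≤ lev x) := by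
  classical
  induction n with
  | zero =>
    intro U C c hU hCU hc
    have := Finset.card_pos.mpr ⟨c, hCU hc⟩
    omega
  | succ n ih =>
    intro U C c hU hCU hc hmin hch hup
    -- it suffices to find a suitable next level
    have key : ∀ (C' : Finset X) (c' : X), C' ⊆ U \ C → c' ∈ C' → (∀ x ∈ C', c' ≤ x) →
        (∀ x ∈ C', ∀ y ∈ C', x ≤ y ∨ y ≤ x) → (∀ x ∈ U \ C, x ∉ C' → ¬ c' ≤ x) →
        (∀ x ∈ U \ C, x ∉ C' → x ≤ c) →
        ∃ lev : X → ℕ, (∀ x ∈ U, lev x = 0 ↔ x ∈ C) ∧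
        (∀ x ∈ U, ∀ y ∈ U, lev x = lev y → x ≤ y ∨ y ≤ x) ∧
        (∀ x ∈ U, ∀ y ∈ U, lev x + 2 ≤ lev y → y ≤ x) ∧
        (∀ x ∈ U, ∀ y ∈ U, x ≤ y → lev y ≤ lev x) := by
      intro C' c' h1 h2 h3 h4 h5 h6
      have hcard : (U \ C).card ≤ n := by
        have : (U \ C).card < U.card :=
          Finset.card_lt_card (Finset.ssubset_iff_of_subset Finset.sdiff_subset |>.mpr
            ⟨c, hCU hc, by simp [hc]⟩)
        omega
      obtain ⟨lev, l0, l1, l2, l3⟩ := ih (U \ C) C' c' hcard h1 h2 h3 h4 h5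
      simp only [Finset.mem_sdiff] at l0 l1 l2 l3 h6
      refine ⟨fun x => if x ∈ C then 0 else lev x + 1, ?_, ?_, ?_, ?_⟩
      · intro x hx
        by_cases hxC : x ∈ C <;> simp [hxC]
      · intro x hx y hy h
        by_cases hxC : x ∈ C <;> by_cases hyC : y ∈ C <;> simp [hxC, hyC] at h
        · exact hch x hxC y hyC
        · exact l1 x ⟨hx, hxC⟩ y ⟨hy, hyC⟩ h
      · intro x hx y hy h
        by_cases hxC : x ∈ C <;> by_cases hyC : y ∈ C <;> simp [hxC, hyC] at h
        · have : y ∉ C' := fun hh => by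
            have := (l0 y ⟨hy, hyC⟩).mpr hh
            omega
          exact (h6 y ⟨hy, hyC⟩ this).trans (hmin x hxC)
        · exact l2 x ⟨hx, hxC⟩ y ⟨hy, hyC⟩ (by omega)
      · intro x hx y hy h
        by_cases hxC : x ∈ C <;> by_cases hyC : y ∈ C <;> simp [hxC, hyC]
        · exact hup y hy hyC ((hmin x hxC).trans h)
        · exact l3 x ⟨hx, hxC⟩ y ⟨hy, hyC⟩ h
    by_cases hE : (U \ C).Nonempty
    · by_cases hC' : ((U \ C).filter (fun x => ¬ x ≤ c)).Nonempty
      · set C' := (U \ C).filter (fun x => ¬ x ≤ c) with hC'def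
        obtain ⟨c', hc'⟩ := C'.exists_minimal hC'
        have memC' : ∀ x, x ∈ C' ↔ (x ∈ U ∧ x ∉ C) ∧ ¬ x ≤ c := by
          intro x; simp [hC'def]
        have chain : ∀ x ∈ C', ∀ y ∈ C', x ≤ y ∨ y ≤ x := by
          intro x hx y hy
          rw [memC'] at hx hy
          have a1 := hup x hx.1.1 hx.1.2
          have a2 := hup y hy.1.1 hy.1.2
          rcases hw x y c with h | h | h
          · exact h
          · tauto
          · tauto
        refine key C' c' (Finset.filter_subset _ _) hc'.1 ?_ chain ?_ ?_
        · intro x hx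
          rcases chain c' hc'.1 x hx with h | h
          · exact h
          · exact hc'.2 hx h
        · intro x hx hxC' hle
          have h1 := (memC' c').mp hc'.1
          have : x ≤ c := by
            by_contra hn
            exact hxC' ((memC' x).mpr ⟨by simpa using hx, hn⟩)
          exact h1.2 (hle.trans this)
        · intro x hx hxC'
          by_contra hn
          exact hxC' ((memC' x).mpr ⟨by simpa using hx, hn⟩)
      · obtain ⟨m, hm⟩ := (U \ C).exists_maximal hE
        have hall : ∀ x ∈ U \ C, x ≤ c := by
          intro x hx
          by_contra hn
          exact hC' ⟨x, by simp only [Finset.mem_filter]; exact ⟨hx, hn⟩⟩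
        refine key {m} m (by simpa using hm.1) (by simp) (by simp) (by simp) ?_ ?_
        · intro x hx hxm hle
          exact hxm (by simpa using le_antisymm (hm.2 hx hle) hle)
        · intro x hx _
          exact hall x hx
    · have hEq : ∀ x ∈ U, x ∈ C := by
        intro x hx
        by_contra hn
        exact hE ⟨x, by simp [hx, hn]⟩
      refine ⟨fun _ => 0, ?_, ?_, ?_, ?_⟩
      · intro x hx
        simp [hEq x hx]
      · intro x hx y hy _
        exact hch x (hEq x hx) y (hEq y hy)
      · intro x hx y hy h
        simp at h
      · intros; exact le_rfl

lemma exists_lev {X : Type*} [PartialOrder X] [Fintype X] [DecidableEq X] [Nonempty X]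
    (hub : ∀ A : Finset X, IsAntichain (· ≤ ·) (A : Set X) → A.card ≤ 2) :
    ∃ lev : X → ℕ, (∀ x y, lev x = lev y → x ≤ y ∨ y ≤ x) ∧
        (∀ x y, lev x + 2 ≤ lev y → y ≤ x) ∧
        (∀ x y, x ≤ y → lev y ≤ lev x) := by
  have hw : ∀ x y z : X, (x ≤ y ∨ y ≤ x) ∨ (y ≤ z ∨ z ≤ y) ∨ (x ≤ z ∨ z ≤ x) := by
    intro x y z
    by_contra hn
    push Not at hn
    obtain ⟨⟨h1, h2⟩, ⟨h3, h4⟩, h5, h6⟩ := hn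
    have e1 : x ≠ y := fun h => h1 h.le
    have e2 : y ≠ z := fun h => h3 h.le
    have e3 : x ≠ z := fun h => h5 h.le
    have hA := hub {x, y, z} (by
      intro a ha b hb hab
      simp at ha hb
      rcases ha with rfl | rfl | rfl <;> rcases hb with rfl | rfl | rfl <;> simp_all)
    rw [Finset.card_eq_three.mpr ⟨x, y, z, e1, e3, e2, rfl⟩] at hA
    omega
  obtain ⟨m, hm⟩ := (Finset.univ : Finset X).exists_maximal Finset.univ_nonempty
  obtain ⟨lev, -, l1, l2, l3⟩ := exists_lev_aux hw (Finset.univ : Finset X).card Finset.univ {m} m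
    le_rfl (by simp) (by simp) (by simp) (by simp) (by
      intro x hx hxm hle
      exact hxm (by simpa using le_antisymm (hm.2 hx hle) hle))
  exact ⟨lev, fun x y => l1 x (by simp) y (by simp), fun x y => l2 x (by simp) y (by simp),
    fun x y => l3 x (by simp) y (by simp)⟩

open Classical in
/-- The fibre of `g` through `x`. -/
noncomputable def fib {X Y : Type*} [Fintype X] (g : X → Y) (x : X) : Finset X :=
  Finset.univ.filter fun y => g y = g x

open Classical in
/-- The partition of `X` into fibres of `g`. -/
noncomputable def fibs {X Y : Type*} [Fintype X] (g : X → Y) : Finset (Finset X) :=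
  Finset.univ.image (fib g)

lemma mem_fib {X Y : Type*} [Fintype X] (g : X → Y) (x y : X) : y ∈ fib g x ↔ g y = g x := by
  simp [fib]

lemma mem_fibs {X Y : Type*} [Fintype X] (g : X → Y) (B : Finset X) :
    B ∈ fibs g ↔ ∃ x, fib g x = B := by
  simp [fibs]

lemma fib_eq_iff {X Y : Type*} [Fintype X] (g : X → Y) (x y : X) :
    fib g x = fib g y ↔ g x = g y := by
  constructor
  · intro h
    rw [← mem_fib, ← h, mem_fib]
  · intro h
    ext z
    simp [mem_fib, h]

lemma fibs_partition {X Y : Type*} [Fintype X] (g : X → Y) : IsPartitionOf (fibs g) := by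
  refine ⟨?_, ?_⟩
  · intro B hB
    obtain ⟨x, rfl⟩ := (mem_fibs g B).mp hB
    exact ⟨x, by simp [mem_fib]⟩
  · intro x
    refine ⟨fib g x, ⟨(mem_fibs _ _).mpr ⟨x, rfl⟩, by simp [mem_fib]⟩, ?_⟩
    rintro B ⟨hB, hx⟩
    obtain ⟨y, rfl⟩ := (mem_fibs g B).mp hB
    rw [mem_fib] at hx
    exact ((fib_eq_iff g x y).mpr hx).symm

lemma fibs_congr {X Y Z : Type*} [Fintype X] (g : X → Y) (g' : X → Z)
    (h : ∀ x y, g' x = g' y ↔ g x = g y) : fibs g' = fibs g := by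
  have : fib g' = fib g := by
    funext x
    ext y
    simp [mem_fib, h]
  unfold fibs
  rw [this]

lemma fibs_step {X Y Z : Type*} [Fintype X] [DecidableEq X] (g : X → Y) (g' : X → Z) (u v : X)
    (h : ∀ x y, g' x = g' y ↔ g x = g y ∨
      ((g x = g u ∨ g x = g v) ∧ (g y = g u ∨ g y = g v))) :
    fibs g' = fibs g ∨ MergeStep (fibs g) (fibs g') := by
  by_cases huv : g u = g v
  · left
    apply fibs_congr
    intro x y
    rw [h]
    constructor
    · rintro (h | ⟨h1 | h1, h2 | h2⟩) <;> simp_all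
    · exact Or.inl
  · right
    refine ⟨fib g u, (mem_fibs _ _).mpr ⟨u, rfl⟩, fib g v, (mem_fibs _ _).mpr ⟨v, rfl⟩,
      fun hh => huv ((fib_eq_iff _ _ _).mp hh), ?_⟩
    have hyes : ∀ x, (g x = g u ∨ g x = g v) → fib g' x = fib g u ∪ fib g v := by
      intro x hx
      ext y
      simp only [mem_fib, Finset.mem_union, h]
      constructor
      · rintro (h | h)
        · rw [h]; exact hx
        · exact h.1
      · intro h
        exact Or.inr ⟨h, hx⟩
    have hno : ∀ x, ¬ (g x = g u ∨ g x = g v) → fib g' x = fib g x := by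
      intro x hx
      ext y
      simp only [mem_fib, h]
      tauto
    ext B
    simp only [Finset.mem_insert, Finset.mem_erase, mem_fibs]
    constructor
    · rintro ⟨x, rfl⟩
      by_cases hx : g x = g u ∨ g x = g v
      · exact Or.inl (hyes x hx)
      · right
        rw [hno x hx]
        refine ⟨fun hh => hx (Or.inr ((fib_eq_iff _ _ _).mp hh)),
          fun hh => hx (Or.inl ((fib_eq_iff _ _ _).mp hh)), x, rfl⟩
    · rintro (rfl | ⟨h1, h2, x, rfl⟩)
      · exact ⟨u, hyes u (Or.inl rfl)⟩
      · refine ⟨x, hno x ?_⟩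
        rintro (hh | hh)
        · exact h2 ((fib_eq_iff _ _ _).mpr hh)
        · exact h1 ((fib_eq_iff _ _ _).mpr hh)

/-- A partition of red degree at most two. -/
def GoodP {X : Type*} [PartialOrder X] (P : Finset (Finset X)) : Prop :=
  IsPartitionOf P ∧ ∀ B ∈ P, redDeg (· ≤ ·) P B ≤ 2

/-- A reachability relation by merge steps through good partitions. -/
def ReachP {X : Type*} [PartialOrder X] [DecidableEq X] (P Q : Finset (Finset X)) : Prop :=
  ∃ (n : ℕ) (f : ℕ → Finset (Finset X)), f 0 = P ∧ f n = Q ∧ (∀ i ≤ n, GoodP (f i)) ∧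
    ∀ i < n, MergeStep (f i) (f (i + 1))

lemma reach_step {X : Type*} [PartialOrder X] [DecidableEq X] {P Q R : Finset (Finset X)}
    (h : ReachP P Q) (hR : GoodP R) (hs : R = Q ∨ MergeStep Q R) : ReachP P R := by
  rcases hs with rfl | hs
  · exact h
  obtain ⟨n, f, h0, hn, hg, hm⟩ := h
  refine ⟨n + 1, fun i => if i ≤ n then f i else R, by simp [h0], by simp, ?_, ?_⟩
  · intro i hi
    by_cases h : i ≤ n
    · simpa [h] using hg i h
    · simpa [h] using hR
  · intro i hi
    by_cases h : i < n
    · have h1 : i ≤ n := by omega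
      have h2 : i + 1 ≤ n := by omega
      simpa [h1, h2] using hm i h
    · have : i = n := by omega
      subst this
      simpa [hn] using hs

/-- The labelling in which the elements of `S` are labelled by level. -/
def lab {X : Type*} [DecidableEq X] (lev : X → ℕ) (S : Finset X) (x : X) : ℕ ⊕ X :=
  if x ∈ S then Sum.inl (lev x) else Sum.inr x

/-- Invariant of the first phase. -/
def TwInv {X : Type*} [PartialOrder X] (lev : X → ℕ) (S : Finset X) : Prop :=
  (∀ x y, lev x = lev y → x ≤ y → x ∈ S → y ∈ S) ∧
  ∀ t ∈ S, ∀ t' ∈ S, lev t = lev t' → ∀ x, x ∉ S → (x ≤ t → x ≤ t') ∧ (t ≤ x → t' ≤ x)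

lemma red_fib {X Y : Type*} [PartialOrder X] [Fintype X] (g : X → Y) (x y : X)
    (h : RedPair (· ≤ ·) (fib g x) (fib g y)) :
    (∃ a b, g a = g x ∧ g b = g y ∧ ¬ a ≤ b) ∧ (∃ a b, g a = g x ∧ g b = g y ∧ ¬ b ≤ a) ∧
    (∃ a b, g a = g x ∧ g b = g y ∧ (a ≤ b ∨ b ≤ a)) := by
  obtain ⟨h1, h2, a, ha, b, hb, hab⟩ := h
  simp only [blockLE, mem_fib] at h1 h2 ha hb
  push Not at h1 h2
  obtain ⟨c, hc, d, hd, hcd⟩ := h1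
  obtain ⟨e, he, f, hf, hef⟩ := h2
  exact ⟨⟨c, d, hc, hd, hcd⟩, ⟨f, e, hf, he, hef⟩, ⟨a, b, ha, hb, hab⟩⟩

lemma good_lab {X : Type*} [PartialOrder X] [Fintype X] [DecidableEq X] (lev : X → ℕ)
    (l2 : ∀ x y, lev x + 2 ≤ lev y → y ≤ x)
    (S : Finset X) (hR : ∀ t ∈ S, ∀ t' ∈ S, lev t = lev t' → ∀ x, x ∉ S →
      (x ≤ t → x ≤ t') ∧ (t ≤ x → t' ≤ x)) : GoodP (fibs (lab lev S)) := by
  classical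
  refine ⟨fibs_partition _, ?_⟩
  intro B hB
  obtain ⟨x, rfl⟩ := (mem_fibs _ _).mp hB
  have labS : ∀ a b, a ∈ S → lab lev S b = lab lev S a → b ∈ S ∧ lev b = lev a := by
    intro a b ha hab
    by_cases hb : b ∈ S <;> simp [lab, ha, hb] at hab
    exact ⟨hb, hab⟩
  have labN : ∀ a b, a ∉ S → lab lev S b = lab lev S a → b = a := by
    intro a b ha hab
    by_cases hb : b ∈ S <;> simp [lab, ha, hb] at hab
    exact hab
  -- red pairs only occur between adjacent levels of `S`
  have main : ∀ y, RedPair (· ≤ ·) (fib (lab lev S) x) (fib (lab lev S) y) →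
      x ∈ S ∧ y ∈ S ∧ lev x ≤ lev y + 1 ∧ lev y ≤ lev x + 1 := by
    intro y hred
    obtain ⟨⟨a, b, ha, hb, hab⟩, ⟨c, d, hc, hd, hcd⟩, ⟨e, f, he, hf, hef⟩⟩ := red_fib _ _ _ hred
    by_cases hx : x ∈ S <;> by_cases hy : y ∈ S
    · obtain ⟨ha1, ha2⟩ := labS _ _ hx ha
      obtain ⟨hb1, hb2⟩ := labS _ _ hy hb
      obtain ⟨hc1, hc2⟩ := labS _ _ hx hc
      obtain ⟨hd1, hd2⟩ := labS _ _ hy hd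
      refine ⟨hx, hy, ?_, ?_⟩
      · by_contra hn
        exact hab (l2 b a (by omega))
      · by_contra hn
        exact hcd (l2 c d (by omega))
    · obtain ⟨ha1, ha2⟩ := labS _ _ hx ha
      obtain ⟨hc1, hc2⟩ := labS _ _ hx hc
      obtain ⟨he1, he2⟩ := labS _ _ hx he
      have := labN _ _ hy hb
      have := labN _ _ hy hd
      have := labN _ _ hy hf
      subst b d f
      rcases hef with hef | hef
      · exact absurd ((hR e he1 a ha1 (by omega) y hy).2 hef) hab
      · exact absurd ((hR e he1 c hc1 (by omega) y hy).1 hef) hcd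
    · obtain ⟨ha1, ha2⟩ := labS _ _ hy hb
      obtain ⟨hc1, hc2⟩ := labS _ _ hy hd
      obtain ⟨he1, he2⟩ := labS _ _ hy hf
      have := labN _ _ hx ha
      have := labN _ _ hx hc
      have := labN _ _ hx he
      subst a c e
      rcases hef with hef | hef
      · exact absurd ((hR f he1 b ha1 (by omega) x hx).1 hef) hab
      · exact absurd ((hR f he1 d hc1 (by omega) x hx).2 hef) hcd
    · have := labN _ _ hx ha
      have := labN _ _ hx hc
      have := labN _ _ hx he
      have := labN _ _ hy hb
      have := labN _ _ hy hd
      have := labN _ _ hy hf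
      subst a c e b d f
      tauto
  unfold redDeg
  refine (Finset.card_le_card (t := {S.filter (fun z => lev z = lev x + 1),
    S.filter (fun z => lev z + 1 = lev x)}) ?_).trans Finset.card_le_two
  intro C hC
  replace hC := (@Finset.mem_filter _ _ (_) _ _).mp hC
  obtain ⟨hC, hne, hred⟩ := hC
  obtain ⟨y, rfl⟩ := (mem_fibs _ _).mp hC
  obtain ⟨hx, hy, h1, h2⟩ := main y hred
  have hfy : fib (lab lev S) y = S.filter (fun z => lev z = lev y) := by
    ext z
    by_cases hz : z ∈ S <;> simp [mem_fib, lab, hy, hz]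
  have hne' : lev y ≠ lev x := by
    intro h
    apply hne
    rw [fib_eq_iff]
    simp [lab, hx, hy, h]
  rw [Finset.mem_insert, Finset.mem_singleton, hfy]
  rcases lt_or_gt_of_ne hne' with h | h
  · right
    ext z
    simp only [Finset.mem_filter]
    constructor <;> rintro ⟨h, h'⟩ <;> exact ⟨h, by omega⟩
  · left
    ext z
    simp only [Finset.mem_filter]
    constructor <;> rintro ⟨h, h'⟩ <;> exact ⟨h, by omega⟩

lemma inv_next {X : Type*} [PartialOrder X] [Fintype X] [DecidableEq X] (lev : X → ℕ)
    (l1 : ∀ x y, lev x = lev y → x ≤ y ∨ y ≤ x)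
    (l2 : ∀ x y, lev x + 2 ≤ lev y → y ≤ x)
    (l3 : ∀ x y, x ≤ y → lev y ≤ lev x)
    (S : Finset X) (hI : TwInv lev S) (hS : ∃ x, x ∉ S) :
    ∃ w, w ∉ S ∧ TwInv lev (insert w S) := by
  classical
  obtain ⟨hU, hR⟩ := hI
  have top : ∀ x, x ∉ S → ∃ w, w ∉ S ∧ lev w = lev x ∧
      ∀ z, z ∉ S → lev z = lev w → z ≤ w := by
    intro x hx
    obtain ⟨w, hw⟩ := (Finset.univ.filter (fun z => z ∉ S ∧ lev z = lev x)).exists_maximal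
      ⟨x, by simp [hx]⟩
    have hw1 : w ∉ S ∧ lev w = lev x := by simpa using hw.1
    refine ⟨w, hw1.1, hw1.2, ?_⟩
    intro z hz hzw
    rcases l1 z w hzw with h | h
    · exact h
    · exact hw.2 (by simp [hz, hzw, hw1.2]) h
  -- candidates
  set K := Finset.univ.filter (fun w => w ∉ S ∧ (∀ z, z ∉ S → lev z = lev w → z ≤ w) ∧
    ∀ y, y ∉ S → lev y + 1 = lev w → w ≤ y → ∀ t ∈ S, lev t = lev w → t ≤ y) with hK
  have hKne : K.Nonempty := by
    obtain ⟨x, hx⟩ := hS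
    obtain ⟨m, hm, hmin⟩ := (Finset.univ.filter (fun z => z ∉ S)).exists_min_image lev
      ⟨x, by simp [hx]⟩
    obtain ⟨w, hw1, hw2, hw3⟩ := top m (by simpa using hm)
    refine ⟨w, ?_⟩
    simp only [hK, Finset.mem_filter, Finset.mem_univ, true_and]
    refine ⟨hw1, hw3, ?_⟩
    intro y hy hyw
    have := hmin y (by simpa using hy)
    omega
  obtain ⟨w, hwK, hwmax⟩ := K.exists_max_image lev hKne
  simp only [hK, Finset.mem_filter, Finset.mem_univ, true_and] at hwK hwmax
  obtain ⟨hwS, hwtop, hB2⟩ := hwK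
  have hB1 : ∀ x, x ∉ S → lev x = lev w + 1 → (∃ t ∈ S, lev t = lev w ∧ x ≤ t) → x ≤ w := by
    intro x hx hxw _
    by_contra hn
    obtain ⟨w', h1, h2, h3⟩ := top x hx
    have := hwmax w' ⟨h1, h3, by
      intro y hy hyw hle
      exfalso
      have := hwtop y hy (by omega)
      exact hn ((h3 x hx (by omega)).trans (hle.trans this))⟩
    omega
  have hbelow : ∀ t ∈ S, lev t = lev w → w ≤ t := by
    intro t ht htw
    rcases l1 t w htw with h | h
    · exact absurd (hU t w htw h ht) hwS
    · exact h
  refine ⟨w, hwS, ?_, ?_⟩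
  · intro x y hxy hle hx
    rw [Finset.mem_insert] at hx ⊢
    rcases hx with rfl | hx
    · by_cases hy : y ∈ S
      · exact Or.inr hy
      · exact Or.inl (le_antisymm (hwtop y hy hxy.symm) hle)
    · exact Or.inr (hU x y hxy hle hx)
  · intro t ht t' ht' htt x hx
    rw [Finset.mem_insert] at ht ht' hx
    push Not at hx
    obtain ⟨hxw, hxS⟩ := hx
    rcases ht with rfl | ht <;> rcases ht' with rfl | ht'
    · exact ⟨id, id⟩
    · refine ⟨fun h => h.trans (hbelow t' ht' htt.symm), fun h => ?_⟩
      have h3 := l3 _ _ h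
      rcases Nat.lt_or_ge (lev x + 1) (lev t) with h4 | h4
      · exact l2 x t' (by omega)
      · rcases Nat.eq_or_lt_of_le h3 with h5 | h5
        · exact absurd (le_antisymm (hwtop x hxS h5) h) hxw
        · exact hB2 x hxS (by omega) h t' ht' htt.symm
    · refine ⟨fun h => ?_, fun h => (hbelow t ht htt).trans h⟩
      have h3 := l3 _ _ h
      rcases Nat.lt_or_ge (lev t + 1) (lev x) with h4 | h4
      · exact l2 t' x (by omega)
      · rcases Nat.eq_or_lt_of_le h3 with h5 | h5
        · exact hwtop x hxS (by omega)
        · exact hB1 x hxS (by omega) ⟨t, ht, htt, h⟩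
    · exact hR t ht t' ht' htt x hxS

lemma phase1 {X : Type*} [PartialOrder X] [Fintype X] [DecidableEq X] (lev : X → ℕ)
    (l1 : ∀ x y, lev x = lev y → x ≤ y ∨ y ≤ x)
    (l2 : ∀ x y, lev x + 2 ≤ lev y → y ≤ x)
    (l3 : ∀ x y, x ≤ y → lev y ≤ lev x) (P : Finset (Finset X)) (n : ℕ) :
    ∀ S : Finset X, Sᶜ.card = n → TwInv lev S → ReachP P (fibs (lab lev S)) →
      ReachP P (fibs (lab lev Finset.univ)) := by
  induction n with
  | zero =>
    intro S hS _ h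
    have : S = Finset.univ := by simpa using hS
    rwa [this] at h
  | succ n ih =>
    intro S hS hI h
    have hx : ∃ x, x ∉ S := by
      have : Sᶜ.Nonempty := Finset.card_pos.mp (by omega)
      obtain ⟨x, hx⟩ := this
      exact ⟨x, by simpa using hx⟩
    obtain ⟨w, hw, hI'⟩ := inv_next lev l1 l2 l3 S hI hx
    refine ih (insert w S) ?_ hI' (reach_step h (good_lab lev l2 _ hI'.2) ?_)
    · rw [Finset.compl_insert, Finset.card_erase_of_mem (by simpa using hw)]
      omega
    · by_cases ht : ∃ t ∈ S, lev t = lev w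
      · obtain ⟨t, ht, htw⟩ := ht
        apply fibs_step _ _ t w
        intro x y
        by_cases hxw : x = w
        · subst hxw
          by_cases hyw : y = x
          · subst hyw; simp
          · by_cases hy : y ∈ S <;> simp [lab, hw, hy, hyw, ht, htw]
            · exact eq_comm
            · exact fun h => hyw h.symm
        · by_cases hyw : y = w
          · subst hyw
            by_cases hx : x ∈ S <;> simp [lab, hw, hx, hxw, ht, htw]
          · by_cases hx : x ∈ S <;> by_cases hy : y ∈ S <;>
              simp [lab, hw, hx, hy, hxw, hyw, ht, htw]
            intro h1 h2
            rw [h1, h2]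
      · left
        push Not at ht
        apply fibs_congr
        intro x y
        by_cases hxw : x = w
        · subst hxw
          by_cases hyw : y = x
          · subst hyw; simp
          · by_cases hy : y ∈ S <;> simp [lab, hw, hy, hyw]
            · exact fun h => ht y hy h.symm
            · exact fun h => hyw h.symm
        · by_cases hyw : y = w
          · subst hyw
            by_cases hx : x ∈ S <;> simp [lab, hw, hx, hxw]
            exact fun h => ht x hx h
          · by_cases hx : x ∈ S <;> by_cases hy : y ∈ S <;>
              simp [lab, hx, hy, hxw, hyw]

lemma phase2 {X : Type*} [PartialOrder X] [Fintype X] [DecidableEq X] (lev : X → ℕ)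
    (l2 : ∀ x y, lev x + 2 ≤ lev y → y ≤ x) (P : Finset (Finset X))
    (h : ReachP P (fibs (lab lev Finset.univ))) (k : ℕ) :
    ReachP P (fibs (lab (fun x => lev x - k) Finset.univ)) := by
  induction k with
  | zero => simpa using h
  | succ k ih =>
    refine reach_step ih (good_lab _ (fun x y hxy => l2 x y (by omega)) _ (by simp)) ?_
    by_cases hu : ∃ u, lev u ≤ k
    · by_cases hv : ∃ v, lev v = k + 1
      · obtain ⟨u, hu⟩ := hu
        obtain ⟨v, hv⟩ := hv
        apply fibs_step _ _ u v
        intro x y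
        simp [lab]
        omega
      · left
        push Not at hv
        apply fibs_congr
        intro x y
        have := hv x
        have := hv y
        simp [lab]
        omega
    · left
      push Not at hu
      apply fibs_congr
      intro x y
      have := hu x
      have := hu y
      simp [lab]
      omega

/-- Every finite poset of width 2 (every antichain has size at most 2)
has natural twin-width at most 2. -/
theorem stmt8 {X : Type*} [PartialOrder X] [Fintype X] [DecidableEq X] [Nonempty X]
    (hub : ∀ A : Finset X, IsAntichain (· ≤ ·) (A : Set X) → A.card ≤ 2) :
    NatTwinWidthLE (· ≤ ·) (X := X) 2 := by
  obtain ⟨lev, l1, l2, l3⟩ := exists_lev hub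
  have hI : TwInv lev (∅ : Finset X) := ⟨by simp, by simp⟩
  have h0 : ReachP (fibs (lab lev (∅ : Finset X))) (fibs (lab lev (∅ : Finset X))) :=
    ⟨0, fun _ => fibs (lab lev (∅ : Finset X)), rfl, rfl,
      fun _ _ => good_lab lev l2 _ hI.2, by simp⟩
  have h1 := phase1 lev l1 l2 l3 _ _ ∅ rfl hI h0
  obtain ⟨n, f, hf0, hfn, hg, hm⟩ := phase2 lev l2 _ h1 (Finset.univ.sup lev)
  refine ⟨n, fun i => f i, fun i => (hg i (by omega)).1, ?_, ?_, ?_, ?_⟩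
  · simp only [Fin.val_zero]
    rw [hf0]
    ext B
    simp only [mem_fibs, Finset.mem_image, Finset.mem_univ, true_and]
    have : ∀ x, fib (lab lev (∅ : Finset X)) x = {x} := by
      intro x
      ext y
      simp [mem_fib, lab]
    simp [this]
  · simp only [Fin.val_last]
    rw [hfn]
    ext B
    rw [mem_fibs, Finset.mem_singleton]
    have : ∀ x, fib (lab (fun x => lev x - Finset.univ.sup lev) Finset.univ) x
        = (Finset.univ : Finset X) := by
      intro x
      ext y
      have hx : lev x ≤ Finset.univ.sup lev := Finset.le_sup (Finset.mem_univ x)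
      have hy : lev y ≤ Finset.univ.sup lev := Finset.le_sup (Finset.mem_univ y)
      simp only [mem_fib, lab, Finset.mem_univ, if_true, iff_true, Sum.inl.injEq]
      omega
    simp [this, eq_comm]
  · intro i
    exact hm i i.2
  · intro i B hB
    exact (hg i (by omega)).2 B hB
end

section
/- The poset P on ten elements a_1 < a_2 < a_3 < a_4 < a_5 and b_1 < b_2 < b_3 < b_4 < b_5 with additional relations a_1 < b_3, b_1 < a_3, a_3 < b_5, b_3 < a_5 (transitively closed) has natural twin-width at least 2; together with the upper bound for width-2 posets, its natural twin-width is exactly 2. -/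
/-- The ten-element poset of the paper: chains `a = ((0,0),…,(0,4))` and
`b = ((1,0),…,(1,4))` (0-indexed), with the cross relations generated by
`a₁ ≤ b₃`, `b₁ ≤ a₃`, `a₃ ≤ b₅`, `b₃ ≤ a₅`, transitively closed:
`x ≤ y` across the chains iff (`x` at level 0 and `y` at level ≥ 2) or
(`x` at level ≤ 2 and `y` at level 4). -/
def pLe : Fin 2 × Fin 5 → Fin 2 × Fin 5 → Prop := fun x y =>
  if x.1 = y.1 then x.2 ≤ y.2
  else (x.2 = 0 ∧ 2 ≤ y.2) ∨ (x.2 ≤ 2 ∧ y.2 = 4)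

instance pLeDecidable (x y : Fin 2 × Fin 5) : Decidable (pLe x y) := by
  unfold pLe; infer_instance

/-- Number of an element of the poset. -/
def idx (x : Fin 2 × Fin 5) : ℕ := 5 * x.1.val + x.2.val

/-- The finset encoded by a bitmask. -/
def fm (m : ℕ) : Finset (Fin 2 × Fin 5) := Finset.univ.filter fun x => m.testBit (idx x) = true

/-- Masks of the complements of the principal up-sets. -/
def notUp : List ℕ :=
  [96, 481, 483, 999, 1007, 3, 47, 111, 255, 511]

/-- Masks of the elements comparable to a given element. -/
def comp : List ℕ :=
  [927, 543, 575, 63, 255, 1020, 1008, 1009, 993, 999]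

theorem mem_fm (m : ℕ) (x : Fin 2 × Fin 5) : x ∈ fm m ↔ m.testBit (idx x) = true := by
  simp [fm]

theorem notUp_spec : ∀ x y, (notUp.getD (idx x) 0).testBit (idx y) = true ↔ ¬ pLe x y := by
  decide +kernel

theorem comp_spec : ∀ x y, (comp.getD (idx x) 0).testBit (idx y) = true ↔ (pLe x y ∨ pLe y x) := by
  decide +kernel

theorem notUp_lt : ∀ x, notUp.getD (idx x) 0 < 1024 := by decide +kernel

theorem comp_lt : ∀ x, comp.getD (idx x) 0 < 1024 := by decide +kernel

theorem exists_idx : ∀ i < 10, ∃ x, idx x = i := by decide +kernel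

theorem idx_lt : ∀ x, idx x < 10 := by decide +kernel

theorem eq_zero_iff (m : ℕ) (hm : m < 1024) : m = 0 ↔ ∀ x, m.testBit (idx x) = false := by
  constructor
  · rintro rfl x; simp
  · intro h
    apply Nat.eq_of_testBit_eq
    intro i
    rw [Nat.zero_testBit]
    by_cases hi : i < 10
    · obtain ⟨x, rfl⟩ := exists_idx i hi
      exact h x
    · apply Nat.testBit_lt_two_pow
      calc m < 2 ^ 10 := hm
        _ ≤ 2 ^ i := Nat.pow_le_pow_right (by norm_num) (by omega)

theorem fm_inj {m n : ℕ} (hm : m < 1024) (hn : n < 1024) (h : fm m = fm n) : m = n := by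
  apply Nat.eq_of_testBit_eq
  intro i
  by_cases hi : i < 10
  · obtain ⟨x, rfl⟩ := exists_idx i hi
    have := Finset.ext_iff.1 h x
    rw [mem_fm, mem_fm] at this
    exact Bool.eq_iff_iff.2 this
  · have hp : 2 ^ 10 ≤ 2 ^ i := Nat.pow_le_pow_right (by norm_num) (by omega)
    rw [Nat.testBit_lt_two_pow (lt_of_lt_of_le hm hp), Nat.testBit_lt_two_pow (lt_of_lt_of_le hn hp)]

theorem fm_or (m n : ℕ) : fm (m ||| n) = fm m ∪ fm n := by
  ext x
  simp [mem_fm, Nat.testBit_or]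

/-- Boolean test: some element of `m` has its `t`-mask meeting `n`. -/
def meets (t : List ℕ) (m n : ℕ) : ℕ → Bool
  | 0 => false
  | k + 1 => (m.testBit k && !(Nat.beq (n &&& t.getD k 0) 0)) || meets t m n k

theorem meets_iff (t : List ℕ) (m n k : ℕ) :
    meets t m n k = true ↔ ∃ i < k, m.testBit i = true ∧ n &&& t.getD i 0 ≠ 0 := by
  induction k with
  | zero => simp [meets]
  | succ k ih =>
    rw [meets, Bool.or_eq_true, ih, Bool.and_eq_true, Bool.not_eq_true', ← Bool.not_eq_true,
      Nat.beq_eq]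
    constructor
    · rintro (h | ⟨i, hi, h⟩)
      · exact ⟨k, by omega, h⟩
      · exact ⟨i, by omega, h⟩
    · rintro ⟨i, hi, h⟩
      rcases Nat.lt_succ_iff_lt_or_eq.1 hi with h' | rfl
      · exact Or.inr ⟨i, h', h⟩
      · exact Or.inl h

theorem meets_spec (t : List ℕ) (ht : ∀ x, t.getD (idx x) 0 < 1024) (m n : ℕ) :
    meets t m n 10 = true ↔
      ∃ x ∈ fm m, ∃ y ∈ fm n, (t.getD (idx x) 0).testBit (idx y) = true := by
  have key : ∀ x, n &&& t.getD (idx x) 0 ≠ 0 ↔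
      ∃ y ∈ fm n, (t.getD (idx x) 0).testBit (idx y) = true := by
    intro x
    rw [Ne, eq_zero_iff _ (lt_of_le_of_lt Nat.and_le_right (ht x))]
    simp only [Nat.testBit_and, mem_fm, not_forall, Bool.not_eq_false, Bool.and_eq_true]
  rw [meets_iff]
  constructor
  · rintro ⟨i, hi, hm, h⟩
    obtain ⟨x, rfl⟩ := exists_idx i hi
    exact ⟨x, (mem_fm _ _).2 hm, (key x).1 h⟩
  · rintro ⟨x, hx, h⟩
    exact ⟨idx x, idx_lt x, (mem_fm _ _).1 hx, (key x).2 h⟩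

/-- Boolean test for red pairs. -/
def redB (m n : ℕ) : Bool := meets notUp m n 10 && meets notUp n m 10 && meets comp m n 10

theorem not_blockLE_iff (m n : ℕ) :
    ¬ blockLE pLe (fm m) (fm n) ↔ meets notUp m n 10 = true := by
  rw [meets_spec _ notUp_lt]
  simp only [notUp_spec, blockLE, not_forall, exists_prop]

theorem redB_spec (m n : ℕ) : redB m n = true ↔ RedPair pLe (fm m) (fm n) := by
  rw [redB, Bool.and_eq_true, Bool.and_eq_true, RedPair, not_blockLE_iff, not_blockLE_iff,
    meets_spec _ comp_lt]
  simp only [comp_spec, and_assoc]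

/-- The set of blocks encoded by a list of masks. -/
def fl (L : List ℕ) : Finset (Finset (Fin 2 × Fin 5)) := (L.map fm).toFinset

theorem mem_fl (L : List ℕ) (B : Finset (Fin 2 × Fin 5)) : B ∈ fl L ↔ ∃ m ∈ L, fm m = B := by
  simp [fl]

/-- Merging two parts of an encoded partition. -/
def mg (L : List ℕ) (m n : ℕ) : List ℕ :=
  (m ||| n) :: L.filter fun k => !(Nat.beq k m) && !(Nat.beq k n)

theorem mem_mg (L : List ℕ) (m n k : ℕ) :
    k ∈ mg L m n ↔ k = m ||| n ∨ (k ∈ L ∧ k ≠ m ∧ k ≠ n) := by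
  simp only [mg, List.mem_cons, List.mem_filter, Bool.and_eq_true, Bool.not_eq_true',
    ← Bool.not_eq_true, Nat.beq_eq, Ne]

theorem fl_mg (L : List ℕ) (hL : ∀ k ∈ L, k < 1024) (m n : ℕ) (hm : m ∈ L) (hn : n ∈ L) :
    fl (mg L m n) = insert (fm m ∪ fm n) (((fl L).erase (fm m)).erase (fm n)) := by
  ext B
  simp only [Finset.mem_insert, Finset.mem_erase, mem_fl, mem_mg]
  constructor
  · rintro ⟨k, rfl | ⟨hk, h1, h2⟩, rfl⟩
    · left; exact fm_or m n
    · right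
      exact ⟨fun h => h2 (fm_inj (hL _ hk) (hL _ hn) h),
        fun h => h1 (fm_inj (hL _ hk) (hL _ hm) h), k, hk, rfl⟩
  · rintro (rfl | ⟨h2, h1, k, hk, rfl⟩)
    · exact ⟨_, Or.inl rfl, fm_or m n⟩
    · exact ⟨k, Or.inr ⟨hk, fun h => h1 (h ▸ rfl), fun h => h2 (h ▸ rfl)⟩, rfl⟩

theorem mg_lt (L : List ℕ) (hL : ∀ k ∈ L, k < 1024) (m n : ℕ) (hm : m ∈ L) (hn : n ∈ L) :
    ∀ k ∈ mg L m n, k < 1024 := by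
  intro k hk
  rcases (mem_mg _ _ _ _).1 hk with rfl | h
  · exact Nat.or_lt_two_pow (n := 10) (hL m hm) (hL n hn)
  · exact hL k h.1

/-- Boolean membership. -/
def memB (k : ℕ) (L : List ℕ) : Bool := L.any fun m => Nat.beq k m

theorem memB_iff (k : ℕ) (L : List ℕ) : memB k L = true ↔ k ∈ L := by
  simp [memB, Nat.beq_eq]

/-- Boolean test that two lists have the same members. -/
def sameB (L M : List ℕ) : Bool := (L.all fun k => memB k M) && (M.all fun k => memB k L)

theorem fl_eq_of_sameB (L M : List ℕ) (h : sameB L M = true) : fl L = fl M := by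
  simp only [sameB, Bool.and_eq_true, List.all_eq_true, memB_iff] at h
  ext B
  simp only [mem_fl]
  exact ⟨fun ⟨m, hm, e⟩ => ⟨m, h.1 m hm, e⟩, fun ⟨m, hm, e⟩ => ⟨m, h.2 m hm, e⟩⟩

/-- The red neighbours of a part. -/
def redNb (L : List ℕ) (d : ℕ) : List ℕ := L.filter fun c => !(Nat.beq c d) && redB d c

theorem redDeg_eq (L : List ℕ) (hL : ∀ k ∈ L, k < 1024) (d : ℕ) (hd : d ∈ L) :
    redDeg pLe (fl L) (fm d) = (redNb L d).toFinset.card := by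
  classical
  have himg : (fl L).filter (fun C => C ≠ fm d ∧ RedPair pLe (fm d) C)
      = (redNb L d).toFinset.image fm := by
    ext B
    simp only [Finset.mem_filter, mem_fl, Finset.mem_image, List.mem_toFinset, redNb,
      List.mem_filter, Bool.and_eq_true, Bool.not_eq_true', ← Bool.not_eq_true, Nat.beq_eq,
      redB_spec]
    constructor
    · rintro ⟨⟨m, hm, rfl⟩, h1, h2⟩
      exact ⟨m, ⟨hm, fun h => h1 (h ▸ rfl), h2⟩, rfl⟩
    · rintro ⟨m, ⟨hm, h1, h2⟩, rfl⟩
      exact ⟨⟨m, hm, rfl⟩, fun h => h1 (fm_inj (hL _ hm) (hL _ hd) h), h2⟩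
  have hcard : ((redNb L d).toFinset.image fm).card = (redNb L d).toFinset.card := by
    apply Finset.card_image_of_injOn
    intro a ha b hb h
    have ha' := (List.mem_filter.1 (List.mem_toFinset.1 (Finset.mem_coe.1 ha))).1
    have hb' := (List.mem_filter.1 (List.mem_toFinset.1 (Finset.mem_coe.1 hb))).1
    exact fm_inj (hL _ ha') (hL _ hb') h
  rw [← hcard, ← himg]
  unfold redDeg
  congr

/-- The partition into singletons. -/
def disc : List ℕ := [1, 2, 4, 8, 16, 32, 64, 128, 256, 512]

theorem fl_disc : fl disc = Finset.univ.image (fun x => ({x} : Finset (Fin 2 × Fin 5))) := by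
  decide +kernel

/-- Boolean test for having two distinct red neighbours. -/
def bad (L : List ℕ) : Bool := L.any fun d =>
  match redNb L d with
  | a :: b :: _ => !(Nat.beq a b)
  | _ => false

theorem bad_spec (L : List ℕ) (hL : ∀ k ∈ L, k < 1024) (h : bad L = true) :
    ∃ D ∈ fl L, 1 < redDeg pLe (fl L) D := by
  obtain ⟨d, hd, h⟩ := List.any_eq_true.1 h
  refine ⟨fm d, (mem_fl _ _).2 ⟨d, hd, rfl⟩, ?_⟩
  rw [redDeg_eq L hL d hd]
  split at h
  · rename_i a b l heq
    rw [Bool.not_eq_true', ← Bool.not_eq_true, Nat.beq_eq] at h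
    rw [Finset.one_lt_card]
    exact ⟨a, by simp [heq], b, by simp [heq], h⟩
  · simp at h

/-- The partitions reachable with red degree at most one. -/
def reach1 : List (List ℕ) :=
  [disc,
    [6, 1, 8, 16, 32, 64, 128, 256, 512],
    [12, 1, 2, 16, 32, 64, 128, 256, 512],
    [192, 1, 2, 4, 8, 16, 32, 256, 512],
    [384, 1, 2, 4, 8, 16, 32, 64, 512],
    [6, 192, 1, 8, 16, 32, 256, 512],
    [6, 384, 1, 8, 16, 32, 64, 512],
    [12, 192, 1, 2, 16, 32, 256, 512],
    [12, 384, 1, 2, 16, 32, 64, 512]]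

theorem reach1_closed : (reach1.all fun L => L.all fun m => L.all fun n =>
    Nat.beq m n || bad (mg L m n) || reach1.any fun M => sameB (mg L m n) M) = true := by
  decide +kernel

theorem reach1_lt : ∀ L ∈ reach1, ∀ k ∈ L, k < 1024 := by
  decide +kernel

theorem reach1_card : ∀ L ∈ reach1, 1 ∈ L ∧ 32 ∈ L := by
  decide +kernel

theorem lower : ¬ NatTwinWidthLE pLe 1 := by
  rintro ⟨n, seq, -, h0, hlast, hstep, hred⟩
  have key : ∀ i : Fin (n + 1), ∃ L ∈ reach1, seq i = fl L := by
    intro i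
    induction i using Fin.induction with
    | zero => exact ⟨disc, List.mem_cons_self, by rw [h0, fl_disc]⟩
    | succ i ih =>
      obtain ⟨L, hL, hs⟩ := ih
      obtain ⟨B, hB, C, hC, hne, hQ⟩ := hstep i
      rw [hs] at hB hC hQ
      obtain ⟨b, hb, rfl⟩ := (mem_fl _ _).1 hB
      obtain ⟨c, hc, rfl⟩ := (mem_fl _ _).1 hC
      rw [← fl_mg L (reach1_lt L hL) b c hb hc] at hQ
      have hcl := List.all_eq_true.1 (List.all_eq_true.1
        (List.all_eq_true.1 reach1_closed L hL) b hb) c hc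
      rw [Bool.or_eq_true, Bool.or_eq_true, Nat.beq_eq] at hcl
      rcases hcl with (h | h) | h
      · exact absurd (congrArg fm h) hne
      · obtain ⟨D, hD, hlt⟩ := bad_spec _ (mg_lt L (reach1_lt L hL) b c hb hc) h
        rw [← hQ] at hD hlt
        have := hred i.succ D hD
        omega
      · obtain ⟨M, hM, hsame⟩ := List.any_eq_true.1 h
        exact ⟨M, hM, by rw [hQ, fl_eq_of_sameB _ _ hsame]⟩
  obtain ⟨L, hL, hs⟩ := key (Fin.last n)
  rw [hlast] at hs
  have h1 : fm 1 ∈ fl L := (mem_fl _ _).2 ⟨1, (reach1_card L hL).1, rfl⟩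
  have h2 : fm 32 ∈ fl L := (mem_fl _ _).2 ⟨32, (reach1_card L hL).2, rfl⟩
  rw [← hs, Finset.mem_singleton] at h1 h2
  have := fm_inj (by norm_num) (by norm_num) (h1.trans h2.symm)
  omega

/-- The pairs merged in a contraction sequence of red degree two. -/
def pairs : Fin 9 → ℕ × ℕ :=
  ![(256, 512), (4, 8), (16, 768), (128, 784), (32, 64), (12, 912), (2, 96), (1, 924), (98, 925)]

/-- The encoded contraction sequence of red degree two. -/
def up : Fin 10 → List ℕ :=
  ![disc,
    [768, 1, 2, 4, 8, 16, 32, 64, 128],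
    [12, 768, 1, 2, 16, 32, 64, 128],
    [784, 12, 1, 2, 32, 64, 128],
    [912, 12, 1, 2, 32, 64],
    [96, 912, 12, 1, 2],
    [924, 96, 1, 2],
    [98, 924, 1],
    [925, 98],
    [1023]]

theorem up_lt : ∀ i, ∀ k ∈ up i, k < 1024 := by
  decide +kernel

theorem up_ne : ∀ i, ∀ k ∈ up i, k ≠ 0 := by
  decide +kernel

theorem up_part : ∀ i, ∀ j < 10, ∃ m ∈ up i, m.testBit j = true ∧
    ∀ k ∈ up i, k.testBit j = true → k = m := by
  decide +kernel

theorem up_step : ∀ i : Fin 9, (pairs i).1 ∈ up i.castSucc ∧ (pairs i).2 ∈ up i.castSucc ∧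
    (pairs i).1 ≠ (pairs i).2 ∧
    sameB (up i.succ) (mg (up i.castSucc) (pairs i).1 (pairs i).2) = true := by
  decide +kernel

theorem up_red : ∀ i, ∀ k ∈ up i, (redNb (up i) k).length ≤ 2 := by
  decide +kernel

theorem upper : NatTwinWidthLE pLe 2 := by
  refine ⟨9, fun i => fl (up i), fun i => ⟨?_, fun x => ?_⟩, fl_disc, ?_, fun i => ?_, ?_⟩
  · intro B hB
    obtain ⟨m, hm, rfl⟩ := (mem_fl _ _).1 hB
    by_contra hne
    apply up_ne i m hm
    rw [eq_zero_iff m (up_lt i m hm)]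
    intro x
    by_contra hx
    exact hne ⟨x, (mem_fm _ _).2 (by simpa using hx)⟩
  · obtain ⟨m, hm, hx, hu⟩ := up_part i (idx x) (idx_lt x)
    refine ⟨fm m, ⟨(mem_fl _ _).2 ⟨m, hm, rfl⟩, (mem_fm _ _).2 hx⟩, ?_⟩
    rintro C ⟨hC, hxC⟩
    obtain ⟨k, hk, rfl⟩ := (mem_fl _ _).1 hC
    rw [hu k hk ((mem_fm _ _).1 hxC)]
  · decide +kernel
  · obtain ⟨h1, h2, hne, hs⟩ := up_step i
    have hlt := up_lt i.castSucc
    refine ⟨fm (pairs i).1, (mem_fl _ _).2 ⟨_, h1, rfl⟩, fm (pairs i).2,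
      (mem_fl _ _).2 ⟨_, h2, rfl⟩, fun h => hne (fm_inj (hlt _ h1) (hlt _ h2) h), ?_⟩
    exact (fl_eq_of_sameB _ _ hs).trans (fl_mg _ hlt _ _ h1 h2)
  · intro i B hB
    obtain ⟨k, hk, rfl⟩ := (mem_fl _ _).1 hB
    simp only
    rw [redDeg_eq _ (up_lt i) k hk]
    exact (List.toFinset_card_le _).trans (up_red i k hk)

theorem pLe_order : IsPartialOrder (Fin 2 × Fin 5) pLe where
  refl := by decide +kernel
  trans := by decide +kernel
  antisymm := by decide +kernel

/-- The ten-element poset `pLe` is a poset of natural twin-width exactly 2: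
its natural twin-width is at least 2 (not at most 1) and at most 2. -/
theorem stmt10 :
    IsPartialOrder (Fin 2 × Fin 5) pLe ∧
    ¬ NatTwinWidthLE pLe 1 ∧ NatTwinWidthLE pLe 2 := by
  exact ⟨pLe_order, lower, upper⟩
end
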